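/- Let E be a complete lattice effect algebra and {x_α : α ∈ A} a family of bounded observables on E with a bounded lower bound y in the Olson order. Then the system x(t) := ⋁_α x_α((-∞,t)), t ∈ ℝ, is a spectral resolution determining a unique bounded observable x which is the greatest lower bound of {x_α} in the Olson order on bounded observables. -/

import Mathlib

structure EffectAlgebra (E : Type*) where
  add : E → E → Option E
  zero : E
  one : E
  comm : ∀ a b, add a b = add b a
  assoc : ∀ a b c, (add a b).bind (fun d => add d c) = (add b c).bind (fun d => add a d)
  orth : ∀ a : E, ∃! b, add a b = some one
  pos_one : ∀ a b, add a one = some b → a = zero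

namespace EffectAlgebra

variable {E : Type*}

/-- The induced order: `a ≤ b` iff `a + c = b` for some `c`. -/
def le (EA : EffectAlgebra E) (a b : E) : Prop := ∃ c, EA.add a c = some b

/-- The orthosupplement `a'`, the unique element with `a + a' = 1`. -/
noncomputable def orthosupp (EA : EffectAlgebra E) (a : E) : E :=
  Classical.choose (EA.orth a).exists

/-- `s` is the supremum of `S` with respect to the induced order. -/
def IsSup (EA : EffectAlgebra E) (S : Set E) (s : E) : Prop :=
  (∀ x ∈ S, EA.le x s) ∧ ∀ b, (∀ x ∈ S, EA.le x b) → EA.le s b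

/-- `s` is the infimum of `S` with respect to the induced order. -/
def IsInf (EA : EffectAlgebra E) (S : Set E) (s : E) : Prop :=
  (∀ x ∈ S, EA.le s x) ∧ ∀ b, (∀ x ∈ S, EA.le b x) → EA.le b s

/-- Every increasing sequence has a supremum. -/
def MonotoneSigmaComplete (EA : EffectAlgebra E) : Prop :=
  ∀ f : ℕ → E, (∀ n, EA.le (f n) (f (n + 1))) → ∃ s, EA.IsSup (Set.range f) s

/-- A σ-lattice effect algebra: countable suprema and infima exist. -/
def SigmaLattice (EA : EffectAlgebra E) : Prop :=
  (∀ f : ℕ → E, ∃ s, EA.IsSup (Set.range f) s) ∧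
  (∀ f : ℕ → E, ∃ s, EA.IsInf (Set.range f) s)

/-- A complete lattice effect algebra: arbitrary suprema and infima exist. -/
def CompleteEA (EA : EffectAlgebra E) : Prop :=
  (∀ S : Set E, ∃ s, EA.IsSup S s) ∧ (∀ S : Set E, ∃ s, EA.IsInf S s)

/-- A lattice effect algebra: binary suprema and infima exist. -/
def LatticeEA (EA : EffectAlgebra E) : Prop :=
  (∀ a b : E, ∃ s, EA.IsSup {a, b} s) ∧ (∀ a b : E, ∃ s, EA.IsInf {a, b} s)

end EffectAlgebra

/-- Borel subsets of the real line. -/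
abbrev BorelSet := {A : Set ℝ // MeasurableSet A}

def bIio (t : ℝ) : BorelSet := ⟨Set.Iio t, measurableSet_Iio⟩
def bIic (t : ℝ) : BorelSet := ⟨Set.Iic t, measurableSet_Iic⟩

/-- An observable on a (monotone σ-complete) effect algebra: a unital,
additive map on the Borel σ-algebra preserving suprema of increasing sequences. -/
structure Observable {E : Type*} (EA : EffectAlgebra E) where
  toFun : BorelSet → E
  unital : toFun ⟨Set.univ, MeasurableSet.univ⟩ = EA.one
  additive : ∀ A B : BorelSet, Disjoint A.1 B.1 →
    EA.add (toFun A) (toFun B) = some (toFun ⟨A.1 ∪ B.1, A.2.union B.2⟩)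
  sup_cont : ∀ f : ℕ → BorelSet, (∀ n, (f n).1 ⊆ (f (n + 1)).1) →
    EA.IsSup (Set.range fun n => toFun (f n))
      (toFun ⟨⋃ n, (f n).1, MeasurableSet.iUnion (fun n => (f n).2)⟩)

namespace Observable

variable {E : Type*} {EA : EffectAlgebra E}

/-- The Olson (spectral) order on observables. -/
def OlsonLe (x y : Observable EA) : Prop :=
  ∀ t : ℝ, EA.le (y.toFun (bIio t)) (x.toFun (bIio t))

/-- An observable is bounded if `x(C) = 1` for some compact set `C`. -/
def Bounded (x : Observable EA) : Prop :=
  ∃ C : Set ℝ, ∃ hC : IsCompact C, x.toFun ⟨C, hC.measurableSet⟩ = EA.one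

/-- `x` is the question observable `q_a` of the element `a`. -/
def IsQuestion (x : Observable EA) (a : E) : Prop :=
  ∀ t : ℝ, x.toFun (bIio t) =
    if t ≤ 0 then EA.zero else if t ≤ 1 then EA.orthosupp a else EA.one

/-- The spectrum of `x` lies in `[0,1]`. -/
def SpectrumIn01 (x : Observable EA) : Prop :=
  x.toFun ⟨Set.Icc 0 1, measurableSet_Icc⟩ = EA.one

/-- `z` is the infimum of `S` in the Olson order on bounded observables. -/
def IsOlsonInf (S : Set (Observable EA)) (z : Observable EA) : Prop :=
  z.Bounded ∧ (∀ x ∈ S, z.OlsonLe x) ∧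
    ∀ w : Observable EA, w.Bounded → (∀ x ∈ S, w.OlsonLe x) → w.OlsonLe z

/-- `z` is the supremum of `S` in the Olson order on bounded observables. -/
def IsOlsonSup (S : Set (Observable EA)) (z : Observable EA) : Prop :=
  z.Bounded ∧ (∀ x ∈ S, x.OlsonLe z) ∧
    ∀ w : Observable EA, w.Bounded → (∀ x ∈ S, x.OlsonLe w) → z.OlsonLe w

end Observable

/-- A spectral resolution: monotone, with infimum 0, supremum 1, left continuous. -/
def SpectralResolution {E : Type*} (EA : EffectAlgebra E) (F : ℝ → E) : Prop :=
  (∀ t s : ℝ, t < s → EA.le (F t) (F s)) ∧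
  EA.IsInf (Set.range F) EA.zero ∧
  EA.IsSup (Set.range F) EA.one ∧
  ∀ s : ℝ, EA.IsSup (F '' Set.Iio s) (F s)

/-- An MV-algebra, presented through its truncated addition and subtraction. -/
class MVLattice (M : Type*) extends Lattice M, OrderTop M, AddCommMonoid M, Sub M where
  tsub_le : ∀ a b c : M, a - b ≤ c ↔ a ≤ c + b
  le_add_right' : ∀ a b : M, a ≤ a + b
  add_tsub' : ∀ a b : M, a ≤ b → b = a + (b - a)
  sub_sub_eq_inf : ∀ a b : M, a - (a - b) = a ⊓ b

namespace MVLattice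

open Set Filter

variable {M : Type*} [MVLattice M]

instance : OrderedSub M := ⟨tsub_le⟩

instance : CanonicallyOrderedAdd M where
  exists_add_of_le {a b} h := ⟨b - a, add_tsub' a b h⟩
  le_add_self a b := by rw [add_comm]; exact le_add_right' a b
  le_self_add := le_add_right'

instance : IsOrderedAddMonoid M where
  add_le_add_left a b h c := by
    rw [← tsub_le]
    exact ((tsub_le _ _ _).2 le_rfl).trans h

theorem eq_zero_of_le {a : M} (h : a ≤ 0) : a = 0 := le_antisymm h zero_le

theorem top_sub_top_sub (a : M) : ⊤ - (⊤ - a) = a := by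
  rw [sub_sub_eq_inf]; simp

theorem le_top_sub_comm {a b : M} (h : a ≤ ⊤ - b) : b ≤ ⊤ - a := by
  have := tsub_le_tsub_left h ⊤
  rwa [top_sub_top_sub] at this

theorem add_sub_self (x y : M) : (x + y) - y = x ⊓ (⊤ - y) := by
  have h : x + y = ⊤ - ((⊤ - y) - x) := by
    rw [tsub_tsub, add_comm y x, top_sub_top_sub]
  rw [h, tsub_tsub, add_comm, ← tsub_tsub, sub_sub_eq_inf, inf_comm]

theorem add_sub_self_of_le {x y : M} (h : x ≤ ⊤ - y) : (x + y) - y = x := by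
  rw [add_sub_self, inf_eq_left.2 h]

theorem sub_inf_right (a b : M) : a - (a ⊓ b) = a - b := by
  rw [← sub_sub_eq_inf, sub_sub_eq_inf, inf_eq_right]
  exact tsub_le_self

theorem sub_add_sub_le (a b : M) : (a - b) + b - a ≤ b - a := by
  rw [tsub_le_iff_right]
  calc (a - b) + b ≤ (a ⊔ b - b) + b := by gcongr; exact le_sup_left
    _ = a ⊔ b := tsub_add_cancel_of_le le_sup_right
    _ ≤ (b - a) + a := sup_le le_add_self le_tsub_add

theorem sub_inf_sub (a b : M) : (a - b) ⊓ (b - a) = 0 := by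
  set m := a ⊓ b with hm
  set z := (a - b) ⊓ (b - a) with hz
  have h1 : z ≤ a - m := by rw [hm, sub_inf_right]; exact inf_le_left
  have h2 : z ≤ b - m := by rw [hm, inf_comm, sub_inf_right]; exact inf_le_right
  have h3 : z + m ≤ m := by
    refine le_inf ?_ ?_
    · calc z + m ≤ (a - m) + m := by gcongr
        _ = a := tsub_add_cancel_of_le inf_le_left
    · calc z + m ≤ (b - m) + m := by gcongr
        _ = b := tsub_add_cancel_of_le inf_le_right
  have h4 : z ≤ ⊤ - m := h1.trans (tsub_le_tsub_right le_top _)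
  apply eq_zero_of_le
  calc z = (z + m) - m := (add_sub_self_of_le h4).symm
    _ ≤ m - m := tsub_le_tsub_right h3 _
    _ = 0 := tsub_self m

theorem sub_eq_self {x y : M} (h : x ⊓ y = 0) : x - y = x := by
  rw [← sub_inf_right, h, tsub_zero]

theorem sub_nsmul_eq_self {x y : M} (h : x ⊓ y = 0) (n : ℕ) : x - n • y = x := by
  induction n with
  | zero => simp
  | succ n ih => rw [succ_nsmul, ← tsub_tsub, ih, sub_eq_self h]

theorem inf_eq_zero_of_le {x y z : M} (h : y ⊓ z = 0) (hx : x ≤ y) : x ⊓ z = 0 :=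
  eq_zero_of_le ((inf_le_inf_right _ hx).trans h.le)

theorem add_inf_eq_zero {x y c : M} (hx : x ⊓ c = 0) (hy : y ⊓ c = 0) : (x + y) ⊓ c = 0 := by
  have h1 : ((x + y) ⊓ c) ⊓ y = 0 := by
    rw [inf_assoc, inf_comm c y, hy]; exact eq_zero_of_le inf_le_right
  have h2 : (x + y) ⊓ c ≤ x := by
    rw [← sub_eq_self h1, tsub_le_iff_right]
    exact inf_le_left
  apply eq_zero_of_le
  rw [← hx]
  exact le_inf h2 inf_le_right

/-- An ideal of an MV-algebra. -/
structure IsMVIdeal (Q : Set M) : Prop where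
  zero_mem : (0 : M) ∈ Q
  down : ∀ {a b : M}, a ≤ b → b ∈ Q → a ∈ Q
  add_mem : ∀ {a b : M}, a ∈ Q → b ∈ Q → a + b ∈ Q

/-- A proper ideal whose quotient is an archimedean chain. -/
structure IsArchIdeal (Q : Set M) : Prop extends IsMVIdeal Q where
  top_notMem : (⊤ : M) ∉ Q
  total : ∀ a b : M, a - b ∈ Q ∨ b - a ∈ Q
  arch : ∀ e : M, e ∉ Q → ∃ n : ℕ, ⊤ - n • e ∈ Q

theorem exists_archIdeal {I : Set M} (hI : IsMVIdeal I) (htop : (⊤ : M) ∉ I) :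
    ∃ Q, I ⊆ Q ∧ IsArchIdeal Q := by
  obtain ⟨Q, hIQ, hQ⟩ := zorn_subset_nonempty {Q : Set M | IsMVIdeal Q ∧ ⊤ ∉ Q} (by
    intro c hc hchain hne
    refine ⟨⋃₀ c, ⟨⟨?_, ?_, ?_⟩, ?_⟩, fun s hs => subset_sUnion_of_mem hs⟩
    · obtain ⟨s, hs⟩ := hne
      exact ⟨s, hs, (hc hs).1.zero_mem⟩
    · rintro a b hab ⟨s, hs, hb⟩
      exact ⟨s, hs, (hc hs).1.down hab hb⟩
    · rintro a b ⟨s, hs, ha⟩ ⟨t, ht, hb⟩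
      rcases hchain.total hs ht with h | h
      · exact ⟨t, ht, (hc ht).1.add_mem (h ha) hb⟩
      · exact ⟨s, hs, (hc hs).1.add_mem ha (h hb)⟩
    · rintro ⟨s, hs, h⟩
      exact (hc hs).2 h) I ⟨hI, htop⟩
  have hQi : IsMVIdeal Q := hQ.prop.1
  have hQt : ⊤ ∉ Q := hQ.prop.2
  have arch : ∀ e : M, e ∉ Q → ∃ n : ℕ, ⊤ - n • e ∈ Q := by
    intro e he
    by_contra! hcon
    let J : Set M := {x | ∃ n : ℕ, x - n • e ∈ Q}
    have hJ : IsMVIdeal J := by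
      refine ⟨⟨0, by simpa using hQi.zero_mem⟩, ?_, ?_⟩
      · rintro a b hab ⟨n, hn⟩
        exact ⟨n, hQi.down (tsub_le_tsub_right hab _) hn⟩
      · rintro a b ⟨n, hn⟩ ⟨k, hk⟩
        refine ⟨n + k, hQi.down ?_ (hQi.add_mem hn hk)⟩
        rw [tsub_le_iff_right, add_nsmul]
        calc a + b ≤ (a - n • e + n • e) + (b - k • e + k • e) :=
              add_le_add le_tsub_add le_tsub_add
          _ = _ := add_add_add_comm _ _ _ _
    have hle : Q ≤ J := fun x hx => ⟨0, by simpa using hx⟩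
    have := hQ.le_of_ge (y := J) ⟨hJ, fun ⟨n, hn⟩ => hcon n hn⟩ hle
    exact he (this ⟨1, by simpa using hQi.zero_mem⟩)
  refine ⟨Q, hIQ, hQi, hQt, ?_, arch⟩
  intro a b
  by_cases h : a - b ∈ Q
  · exact Or.inl h
  right
  obtain ⟨n, hn⟩ := arch _ h
  refine hQi.down ?_ hn
  have h0 : (b - a) ⊓ (a - b) = 0 := by rw [inf_comm]; exact sub_inf_sub a b
  calc b - a = (b - a) - n • (a - b) := (sub_nsmul_eq_self h0 n).symm
    _ ≤ ⊤ - n • (a - b) := tsub_le_tsub_right le_top _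

/-- A `[0,1]`-valued state of an MV-algebra whose kernel is prime. -/
structure PrimeState (M : Type*) [MVLattice M] where
  toFun : M → ℝ
  nonneg : ∀ a, 0 ≤ toFun a
  top : toFun ⊤ = 1
  add : ∀ a b, a ≤ ⊤ - b → toFun (a + b) = toFun a + toFun b
  prime : ∀ a b, toFun (a - b) = 0 ∨ toFun (b - a) = 0

namespace PrimeState

variable (φ : PrimeState M)

theorem sub_of_le {a b : M} (h : b ≤ a) : φ.toFun (a - b) = φ.toFun a - φ.toFun b := by
  have h1 := φ.add (a - b) b (tsub_le_tsub_right le_top _)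
  rw [tsub_add_cancel_of_le h] at h1
  linarith

theorem mono {a b : M} (h : a ≤ b) : φ.toFun a ≤ φ.toFun b := by
  have := φ.sub_of_le h
  have := φ.nonneg (b - a)
  linarith

theorem map_zero : φ.toFun 0 = 0 := by
  have := φ.sub_of_le (le_refl (0 : M))
  simpa using this

theorem le_one (a : M) : φ.toFun a ≤ 1 := φ.top ▸ φ.mono le_top

theorem add_le (a b : M) : φ.toFun (a + b) ≤ φ.toFun a + φ.toFun b := by
  have h1 := φ.sub_of_le (le_add_self : b ≤ a + b)
  have h2 : φ.toFun ((a + b) - b) ≤ φ.toFun a :=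
    φ.mono (by rw [tsub_le_iff_right])
  linarith

theorem nsmul_le (n : ℕ) (a : M) : φ.toFun (n • a) ≤ n * φ.toFun a := by
  induction n with
  | zero => simp [φ.map_zero]
  | succ n ih =>
    rw [succ_nsmul]
    have := φ.add_le (n • a) a
    push_cast
    linarith

theorem sub_eq_zero {a b : M} (h : φ.toFun a ≤ φ.toFun b) : φ.toFun (a - b) = 0 := by
  rcases φ.prime a b with h0 | h0
  · exact h0
  · rw [← sub_inf_right, φ.sub_of_le inf_le_left] at h0 ⊢
    rw [inf_comm] at h0
    have := φ.mono (inf_le_left : a ⊓ b ≤ a)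
    linarith

end PrimeState

namespace IsMVIdeal

variable {Q : Set M}

theorem trans (hQ : IsMVIdeal Q) {a b c : M} (h1 : a - b ∈ Q) (h2 : b - c ∈ Q) : a - c ∈ Q :=
  hQ.down tsub_le_tsub_add_tsub (hQ.add_mem h1 h2)

theorem sub_mem_of_le (hQ : IsMVIdeal Q) {a b : M} (h : a ≤ b) : a - b ∈ Q := by
  rw [tsub_eq_zero_of_le h]; exact hQ.zero_mem

theorem nsmul_mono (hQ : IsMVIdeal Q) {a b : M} (h : a - b ∈ Q) (n : ℕ) : n • a - n • b ∈ Q := by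
  induction n with
  | zero => simpa using hQ.zero_mem
  | succ n ih =>
    rw [succ_nsmul, succ_nsmul]
    exact hQ.down (add_tsub_add_le_tsub_add_tsub) (hQ.add_mem ih h)

end IsMVIdeal

/-- The least number of copies of `e` needed to cover `m` modulo `Q`. -/
noncomputable def coverCount (Q : Set M) (e m : M) : ℕ := sInf {n : ℕ | m - n • e ∈ Q}

namespace IsArchIdeal

variable {Q : Set M} {e : M}

theorem coverCount_spec (hQ : IsArchIdeal Q) (he : e ∉ Q) (m : M) :
    m - coverCount Q e m • e ∈ Q := by
  obtain ⟨n, hn⟩ := hQ.arch e he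
  have hne : {n : ℕ | m - n • e ∈ Q}.Nonempty :=
    ⟨n, hQ.down (tsub_le_tsub_right le_top _) hn⟩
  exact Nat.sInf_mem hne

theorem coverCount_le {m : M} {n : ℕ} (h : m - n • e ∈ Q) : coverCount Q e m ≤ n :=
  Nat.sInf_le h

theorem nsmul_sub_mem (hQ : IsArchIdeal Q) {m : M} {n : ℕ} (h : n < coverCount Q e m) :
    n • e - m ∈ Q :=
  (hQ.total m (n • e)).resolve_left (Nat.notMem_of_lt_sInf h)

theorem coverCount_of_mem {m : M} (h : m ∈ Q) : coverCount Q e m = 0 :=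
  Nat.le_zero.1 (coverCount_le (by simpa using h))

theorem coverCount_mono (hQ : IsArchIdeal Q) (he : e ∉ Q) {a b : M} (h : a ≤ b) :
    coverCount Q e a ≤ coverCount Q e b :=
  coverCount_le (hQ.down (tsub_le_tsub_right h _) (hQ.coverCount_spec he b))

theorem coverCount_add_le (hQ : IsArchIdeal Q) (he : e ∉ Q) (a b : M) :
    coverCount Q e (a + b) ≤ coverCount Q e a + coverCount Q e b := by
  apply coverCount_le
  rw [add_nsmul]
  exact hQ.down add_tsub_add_le_tsub_add_tsub
    (hQ.add_mem (hQ.coverCount_spec he a) (hQ.coverCount_spec he b))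

theorem add_coverCount_le (hQ : IsArchIdeal Q) (he : e ∉ Q) {a b : M} (hab : a ≤ ⊤ - b) {p : ℕ}
    (hp : p • e - a ∈ Q) (hpa : p ≤ coverCount Q e a) :
    p + coverCount Q e b ≤ coverCount Q e (a + b) := by
  set n := coverCount Q e (a + b) with hn
  have hpn : p ≤ n := hpa.trans (hQ.coverCount_mono he le_self_add)
  suffices h : coverCount Q e b ≤ n - p by omega
  apply coverCount_le
  have hb : b = (a + b) - a := by
    rw [add_comm, add_sub_self_of_le (le_top_sub_comm hab)]
  have h1 : b - (n - p) • e = (a + b) - (a + (n - p) • e) := by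
    conv_lhs => rw [hb, tsub_tsub]
  rw [h1]
  refine hQ.trans (hQ.coverCount_spec he (a + b)) ?_
  rw [← hn]
  have h2 : n • e = p • e + (n - p) • e := by
    rw [← add_nsmul]; congr 1; omega
  rw [h2]
  exact hQ.down add_tsub_add_le_tsub_right hp

theorem coverCount_top_pos (hQ : IsArchIdeal Q) (he : e ∉ Q) : 0 < coverCount Q e ⊤ := by
  rcases Nat.eq_zero_or_pos (coverCount Q e ⊤) with h | h
  · have := hQ.coverCount_spec he ⊤
    rw [h, zero_nsmul, tsub_zero] at this
    exact absurd this hQ.top_notMem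
  · exact h

theorem le_coverCount_add_one (hQ : IsArchIdeal Q) (he : e ∉ Q) {a b : M} (hab : a ≤ ⊤ - b) :
    coverCount Q e a + coverCount Q e b ≤ coverCount Q e (a + b) + 1 := by
  rcases Nat.eq_zero_or_pos (coverCount Q e a) with h | h
  · have := hQ.coverCount_mono he (le_add_self : b ≤ a + b)
    omega
  · have := hQ.add_coverCount_le he hab (p := coverCount Q e a - 1)
      (hQ.nsmul_sub_mem (by omega)) (by omega)
    omega

/-- A noninfinitesimal element strictly below `e` yields one that fits twice into `e`. -/
theorem exists_coverCount_lt (hQ : IsArchIdeal Q) {x : M} (hx : x ∉ Q)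
    (hex : e - x ∉ Q) : ∃ y, y ∉ Q ∧ coverCount Q e ⊤ < coverCount Q y ⊤ := by
  obtain ⟨y, hy, hye, hyey⟩ : ∃ y, y ∉ Q ∧ y - e ∈ Q ∧ y - (e - y) ∈ Q := by
    rcases hQ.total x (e - x) with h | h
    · exact ⟨x, hx, (hQ.total e x).resolve_left hex, h⟩
    · refine ⟨e - x, hex, hQ.sub_mem_of_le tsub_le_self, ?_⟩
      rw [sub_sub_eq_inf]
      refine hQ.trans h ?_
      rw [inf_comm, sub_inf_right]
      exact (hQ.total e x).resolve_left hex
  refine ⟨y, hy, ?_⟩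
  have hspec := hQ.coverCount_spec hy ⊤
  have hpos := hQ.coverCount_top_pos hy
  set n := coverCount Q y ⊤
  have hn1 : n ≠ 1 := by
    intro h
    rw [h, one_nsmul] at hspec
    have h1 : y - 0 ∈ Q := by
      refine hQ.trans hyey ?_
      rw [tsub_zero]
      exact hQ.down (tsub_le_tsub_right le_top _) hspec
    rw [tsub_zero] at h1
    exact hy h1
  suffices h : coverCount Q e ⊤ ≤ n - 1 by omega
  apply coverCount_le
  have hn : n • y = (n - 2) • y + (y + y) := by
    rw [← two_nsmul, ← add_nsmul]; congr 1; omega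
  have hn' : (n - 1) • e = (n - 2) • e + e := by
    rw [← succ_nsmul]; congr 1; omega
  refine hQ.trans hspec ?_
  rw [hn, hn']
  refine hQ.down add_tsub_add_le_tsub_add_tsub (hQ.add_mem (hQ.nsmul_mono hye _) ?_)
  refine hQ.trans (b := (e - y) + y) (hQ.down add_tsub_add_le_tsub_right hyey) ?_
  exact hQ.down (sub_add_sub_le e y) hye

end IsArchIdeal

namespace IsArchIdeal

variable {Q : Set M}

theorem exists_primeState_of_unbounded (hQ : IsArchIdeal Q)
    (hunb : ∀ N : ℕ, ∃ e, e ∉ Q ∧ N < coverCount Q e ⊤) :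
    ∃ φ : PrimeState M, ∀ q ∈ Q, φ.toFun q = 0 := by
  choose e he hN using hunb
  let f : M → ℕ → ℝ := fun m N => (coverCount Q (e N) m : ℝ) / coverCount Q (e N) ⊤
  have hpos : ∀ N, (0 : ℝ) < coverCount Q (e N) ⊤ := fun N => by
    exact_mod_cast hQ.coverCount_top_pos (he N)
  have hf : ∀ m N, f m N ∈ Icc (0 : ℝ) 1 := by
    intro m N
    refine ⟨by positivity, ?_⟩
    rw [div_le_one (hpos N)]
    exact_mod_cast hQ.coverCount_mono (he N) le_top
  have hlim : ∀ m, ∃ l, Tendsto (f m) (hyperfilter ℕ) (nhds l) := by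
    intro m
    obtain ⟨l, -, hl⟩ := isCompact_Icc.ultrafilter_le_nhds ((hyperfilter ℕ).map (f m))
      (by
        rw [le_principal_iff]
        exact Filter.mem_map.2 (Filter.univ_mem' (hf m)))
    exact ⟨l, hl⟩
  choose l hl using hlim
  have hzero : ∀ q ∈ Q, l q = 0 := by
    intro q hq
    refine tendsto_nhds_unique (hl q) ?_
    have : f q = fun _ => 0 := by
      ext N; simp [f, coverCount_of_mem hq]
    rw [this]; exact tendsto_const_nhds
  refine ⟨⟨l, ?_, ?_, ?_, ?_⟩, hzero⟩
  · intro a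
    exact ge_of_tendsto (hl a) (Filter.Eventually.of_forall fun N => (hf a N).1)
  · refine tendsto_nhds_unique (hl ⊤) ?_
    have : f ⊤ = fun _ => 1 := by
      ext N; exact div_self (hpos N).ne'
    rw [this]; exact tendsto_const_nhds
  · intro a b hab
    have h1 : Tendsto (fun N => f (a + b) N - (f a N + f b N)) (hyperfilter ℕ)
        (nhds (l (a + b) - (l a + l b))) := (hl _).sub ((hl a).add (hl b))
    have h2 : Tendsto (fun N => f (a + b) N - (f a N + f b N)) (hyperfilter ℕ) (nhds 0) := by
      have h3 : Tendsto (fun N : ℕ => 1 / ((N : ℝ) + 1)) (hyperfilter ℕ) (nhds 0) :=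
        tendsto_one_div_add_atTop_nhds_zero_nat.mono_left
          (Nat.hyperfilter_le_atTop)
      refine squeeze_zero_norm (fun N => ?_) h3
      have hup : (coverCount Q (e N) (a + b) : ℝ) ≤
          coverCount Q (e N) a + coverCount Q (e N) b := by
        exact_mod_cast hQ.coverCount_add_le (he N) a b
      have hlow : (coverCount Q (e N) a : ℝ) + coverCount Q (e N) b ≤
          coverCount Q (e N) (a + b) + 1 := by
        exact_mod_cast hQ.le_coverCount_add_one (he N) hab
      have hNN : (N : ℝ) + 1 ≤ coverCount Q (e N) ⊤ := by
        exact_mod_cast hN N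
      have heq : f (a + b) N - (f a N + f b N) = (coverCount Q (e N) (a + b) -
          (coverCount Q (e N) a + coverCount Q (e N) b)) / coverCount Q (e N) ⊤ := by
        simp only [f]; ring
      rw [heq, Real.norm_eq_abs, abs_div, abs_of_pos (hpos N)]
      have habs : |(coverCount Q (e N) (a + b) : ℝ) -
          (coverCount Q (e N) a + coverCount Q (e N) b)| ≤ 1 := by
        rw [abs_le]; constructor <;> linarith
      exact div_le_div₀ zero_le_one habs (by positivity) hNN
    have := tendsto_nhds_unique h1 h2
    linarith
  · intro a b
    rcases hQ.total a b with h | h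
    · exact Or.inl (hzero _ h)
    · exact Or.inr (hzero _ h)

theorem exists_primeState_of_atom (hQ : IsArchIdeal Q) {e : M} (he : e ∉ Q)
    (hmin : ∀ x, x ∉ Q → e - x ∈ Q) : ∃ φ : PrimeState M, ∀ q ∈ Q, φ.toFun q = 0 := by
  have hexact : ∀ a, coverCount Q e a • e - a ∈ Q := by
    intro a
    rcases Nat.eq_zero_or_pos (coverCount Q e a) with h | h
    · rw [h]; simpa using hQ.zero_mem
    set n := coverCount Q e a with hn
    have h1 : a - (n - 1) • e ∉ Q := fun h1 => by
      have := coverCount_le h1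
      omega
    have h2 := hmin _ h1
    have hn' : n • e = e + (n - 1) • e := by
      rw [← succ_nsmul']; congr 1; omega
    rw [hn']
    refine hQ.trans (hQ.down add_tsub_add_le_tsub_add_tsub
      (hQ.add_mem h2 (hQ.sub_mem_of_le (le_refl ((n - 1) • e))))) ?_
    exact hQ.down (sub_add_sub_le _ _) (hQ.nsmul_sub_mem (by omega))
  have hpos : (0 : ℝ) < coverCount Q e ⊤ := by exact_mod_cast hQ.coverCount_top_pos he
  have hzero : ∀ q ∈ Q, (coverCount Q e q : ℝ) / coverCount Q e ⊤ = 0 := by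
    intro q hq
    simp [coverCount_of_mem hq]
  refine ⟨⟨fun m => (coverCount Q e m : ℝ) / coverCount Q e ⊤, ?_, ?_, ?_, ?_⟩, hzero⟩
  · intro a; positivity
  · exact div_self hpos.ne'
  · intro a b hab
    have h1 := hQ.coverCount_add_le he a b
    have h2 := hQ.add_coverCount_le he hab (hexact a) le_rfl
    have h3 : coverCount Q e (a + b) = coverCount Q e a + coverCount Q e b := le_antisymm h1 h2
    simp only [h3]
    push_cast
    ring
  · intro a b
    rcases hQ.total a b with h | h
    · exact Or.inl (hzero _ h)
    · exact Or.inr (hzero _ h)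

theorem exists_primeState (hQ : IsArchIdeal Q) :
    ∃ φ : PrimeState M, ∀ q ∈ Q, φ.toFun q = 0 := by
  by_cases hunb : ∀ N : ℕ, ∃ e, e ∉ Q ∧ N < coverCount Q e ⊤
  · exact hQ.exists_primeState_of_unbounded hunb
  push Not at hunb
  obtain ⟨N, hN⟩ := hunb
  let S : Set ℕ := {n | ∃ e, e ∉ Q ∧ coverCount Q e ⊤ = n}
  have hbdd : BddAbove S := ⟨N, by rintro n ⟨e, he, rfl⟩; exact hN e he⟩
  obtain ⟨e, he, hmax⟩ := Nat.sSup_mem (s := S) ⟨_, ⊤, hQ.top_notMem, rfl⟩ hbdd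
  refine hQ.exists_primeState_of_atom he fun x hx => ?_
  by_contra hex
  obtain ⟨y, hy, hlt⟩ := hQ.exists_coverCount_lt hx hex
  have := le_csSup hbdd (show coverCount Q y ⊤ ∈ S from ⟨y, hy, rfl⟩)
  omega

end IsArchIdeal

theorem exists_primeState_of_ideal {I : Set M} (hI : IsMVIdeal I) (htop : (⊤ : M) ∉ I) :
    ∃ φ : PrimeState M, ∀ q ∈ I, φ.toFun q = 0 := by
  obtain ⟨Q, hIQ, hQ⟩ := exists_archIdeal hI htop
  obtain ⟨φ, hφ⟩ := hQ.exists_primeState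
  exact ⟨φ, fun q hq => hφ q (hIQ hq)⟩

theorem exists_sub_top_sub_nsmul_ne_zero (hsup : ∀ f : ℕ → M, ∃ s, IsLUB (range f) s) {c : M}
    (hc : c ≠ 0) : ∃ n : ℕ, c - (⊤ - n • c) ≠ 0 := by
  by_contra! h
  obtain ⟨s, hs⟩ := hsup fun n => n • c
  have h1 : s ≤ s - c := by
    refine hs.2 ?_
    rintro _ ⟨n, rfl⟩
    have h2 : n • c ≤ ⊤ - c := le_top_sub_comm (tsub_eq_zero_iff_le.1 (h n))
    calc n • c = (n • c + c) - c := (add_sub_self_of_le h2).symm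
      _ = (n + 1) • c - c := by rw [succ_nsmul]
      _ ≤ s - c := tsub_le_tsub_right (hs.1 ⟨n + 1, rfl⟩) _
  have h3 : c ≤ s := hs.1 ⟨1, one_nsmul c⟩
  apply hc
  rw [← inf_eq_right.2 h3, ← sub_sub_eq_inf]
  exact tsub_eq_zero_of_le h1

theorem exists_sub_nsmul_ne_zero {d : ℕ → M} (hd : Antitone d) (hglb : IsGLB (range d) 0) {c : M}
    (hc : c ≠ 0) (k : ℕ) : ∃ n, c - k • d n ≠ 0 := by
  by_contra! h
  have h' : ∀ n, c ≤ k • d n := fun n => tsub_eq_zero_iff_le.1 (h n)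
  clear h
  apply hc
  induction k with
  | zero => exact eq_zero_of_le (by simpa using h' 0)
  | succ k ih =>
    refine ih fun l => ?_
    rw [← tsub_eq_zero_iff_le]
    refine eq_zero_of_le (hglb.2 ?_)
    rintro _ ⟨n, rfl⟩
    have h1 : c ≤ d (max n l) + k • d (max n l) := by
      rw [← succ_nsmul']; exact h' _
    rw [tsub_le_iff_right]
    exact h1.trans (add_le_add (hd (le_max_left _ _)) (nsmul_le_nsmul_right (hd (le_max_right _ _)) k))

theorem top_sub_succ_nsmul_inf (c : M) (n : ℕ) :
    (⊤ - (n + 1) • c) ⊓ (c - (⊤ - n • c)) = 0 := by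
  rw [succ_nsmul, ← tsub_tsub]
  exact sub_inf_sub _ _

theorem PrimeState.nsmul_le_one (φ : PrimeState M) {d : M} {k : ℕ}
    (h : ∀ j < k, φ.toFun (d - (⊤ - j • d)) = 0) : k * φ.toFun d ≤ 1 := by
  suffices h' : ∀ j ≤ k, j * φ.toFun d ≤ φ.toFun (j • d) from (h' k le_rfl).trans (φ.le_one _)
  intro j hj
  induction j with
  | zero => simp [φ.map_zero]
  | succ j ih =>
    have h1 := φ.sub_of_le (le_add_self : j • d ≤ d + j • d)
    rw [add_sub_self, ← sub_sub_eq_inf, φ.sub_of_le tsub_le_self, h j hj] at h1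
    have h2 := ih (by omega)
    rw [succ_nsmul']
    push_cast
    linarith

/-- A Rasiowa–Sikorski lemma for states: countably many infima can be preserved by a state that
is positive on a prescribed nonzero element. -/
theorem exists_primeState_generic (hsup : ∀ f : ℕ → M, ∃ s, IsLUB (range f) s) {c : M}
    (hc : c ≠ 0) (d : ℕ → ℕ → M) (hanti : ∀ i, Antitone (d i))
    (hglb : ∀ i, IsGLB (range (d i)) 0) :
    ∃ φ : PrimeState M, 0 < φ.toFun c ∧ ∀ i, ∀ ε > 0, ∃ n, φ.toFun (d i n) < ε := by
  obtain ⟨n₀, hn₀⟩ := exists_sub_top_sub_nsmul_ne_zero hsup hc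
  choose g hg using fun (c : {c : M // c ≠ 0}) (s : ℕ) =>
    exists_sub_nsmul_ne_zero (hanti s.unpair.1) (hglb s.unpair.1) c.2 s.unpair.2
  let u : ℕ → {c : M // c ≠ 0} := fun s =>
    Nat.rec ⟨c - (⊤ - n₀ • c), hn₀⟩ (fun s v => ⟨v.1 - s.unpair.2 • d s.unpair.1 (g v s), hg v s⟩) s
  have hu : ∀ s, (u (s + 1)).1 = (u s).1 - s.unpair.2 • d s.unpair.1 (g (u s) s) := fun s => rfl
  have huanti : Antitone fun s => (u s).1 :=
    antitone_nat_of_succ_le fun s => by rw [hu]; exact tsub_le_self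
  let I : Set M := {x | ∃ s, x ⊓ (u s).1 = 0}
  have hI : IsMVIdeal I := by
    refine ⟨⟨0, inf_eq_left.2 zero_le⟩, ?_, ?_⟩
    · rintro a b hab ⟨s, hs⟩
      exact ⟨s, inf_eq_zero_of_le hs hab⟩
    · rintro a b ⟨s, hs⟩ ⟨t, ht⟩
      refine ⟨max s t, add_inf_eq_zero (eq_zero_of_le ?_) (eq_zero_of_le ?_)⟩
      · exact (inf_le_inf_left _ (huanti (le_max_left s t))).trans hs.le
      · exact (inf_le_inf_left _ (huanti (le_max_right s t))).trans ht.le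
  have htop : (⊤ : M) ∉ I := by
    rintro ⟨s, hs⟩
    rw [top_inf_eq] at hs
    exact (u s).2 hs
  obtain ⟨φ, hφ⟩ := exists_primeState_of_ideal hI htop
  refine ⟨φ, ?_, ?_⟩
  · have h1 : φ.toFun (⊤ - (n₀ + 1) • c) = 0 := hφ _ ⟨0, top_sub_succ_nsmul_inf c n₀⟩
    rw [φ.sub_of_le le_top, φ.top] at h1
    have h2 := φ.nsmul_le (n₀ + 1) c
    by_contra h3
    have h4 : φ.toFun c = 0 := le_antisymm (not_lt.1 h3) (φ.nonneg c)
    rw [h4] at h2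
    linarith
  · intro i ε hε
    obtain ⟨k, hk⟩ := exists_nat_gt (1 / ε)
    set s := Nat.pair i k with hs
    refine ⟨g (u s) s, ?_⟩
    set e := d i (g (u s) s) with he
    have hus : (u (s + 1)).1 = (u s).1 - k • e := by
      rw [hu]; simp [hs, he]
    have h1 : k * φ.toFun e ≤ 1 := by
      refine φ.nsmul_le_one fun j hj => hφ _ ⟨s + 1, ?_⟩
      rw [inf_comm]
      refine inf_eq_zero_of_le (top_sub_succ_nsmul_inf e j) ?_
      rw [hus]
      exact tsub_le_tsub le_top (nsmul_le_nsmul_left zero_le hj)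
    rw [div_lt_iff₀ hε] at hk
    have hk0 : (0 : ℝ) < k := by
      by_contra h0
      have : (k : ℝ) * ε ≤ 0 := mul_nonpos_of_nonpos_of_nonneg (not_lt.1 h0) hε.le
      linarith
    have h2 : k * φ.toFun e < k * ε := by linarith
    exact lt_of_mul_lt_mul_left h2 hk0.le

/-- The filter of sets of states containing all states that preserve countably many prescribed
infima of decreasing sequences. -/
def generic (M : Type*) [MVLattice M] : Filter (PrimeState M) :=
  countableGenerate {s | ∃ d : ℕ → M, Antitone d ∧ IsGLB (range d) 0 ∧
    s = {φ | ∀ ε > 0, ∃ n, φ.toFun (d n) < ε}}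

instance : CountableInterFilter (generic M) := by
  unfold generic; infer_instance

theorem eventually_generic {d : ℕ → M} (hd : Antitone d) (hglb : IsGLB (range d) 0) :
    ∀ᶠ φ in generic M, ∀ ε > 0, ∃ n, φ.toFun (d n) < ε := by
  refine mem_countableGenerate_iff.2 ⟨_, singleton_subset_iff.2 ⟨d, hd, hglb, rfl⟩,
    countable_singleton _, ?_⟩
  rw [sInter_singleton]

theorem eq_zero_of_eventually (hsup : ∀ f : ℕ → M, ∃ s, IsLUB (range f) s) {c : M}
    (h : ∀ᶠ φ in generic M, φ.toFun c = 0) : c = 0 := by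
  by_contra hc
  obtain ⟨S, hS, hcount, hsub⟩ := mem_countableGenerate_iff.1 h
  have hz : Antitone (fun _ : ℕ => (0 : M)) ∧ IsGLB (range fun _ : ℕ => (0 : M)) 0 :=
    ⟨antitone_const, by rw [range_const]; exact isGLB_singleton⟩
  obtain ⟨e, he⟩ := (hcount.insert {φ : PrimeState M | ∀ ε > 0, ∃ n : ℕ,
    φ.toFun ((fun _ : ℕ => (0 : M)) n) < ε}).exists_eq_range (insert_nonempty _ _)
  have hmem : ∀ i, ∃ d : ℕ → M, Antitone d ∧ IsGLB (range d) 0 ∧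
      e i = {φ | ∀ ε > 0, ∃ n, φ.toFun (d n) < ε} := by
    intro i
    have : e i ∈ insert _ S := he ▸ mem_range_self i
    rcases this with h | h
    · exact ⟨_, hz.1, hz.2, h⟩
    · exact hS h
  choose d hd hglb hed using hmem
  obtain ⟨φ, hφc, hφ⟩ := exists_primeState_generic hsup hc d hd hglb
  refine hφc.ne' (hsub ?_)
  intro s hs
  have : s ∈ range e := he ▸ mem_insert_of_mem _ hs
  obtain ⟨i, rfl⟩ := this
  rw [hed]
  exact hφ i

theorem le_of_eventually (hsup : ∀ f : ℕ → M, ∃ s, IsLUB (range f) s) {a b : M}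
    (h : ∀ᶠ φ in generic M, φ.toFun a ≤ φ.toFun b) : a ≤ b := by
  rw [← tsub_eq_zero_iff_le]
  exact eq_zero_of_eventually hsup (h.mono fun φ hφ => φ.sub_eq_zero hφ)

theorem isGLB_sub {m : ℕ → M} {s : M} (h : IsLUB (range m) s) :
    IsGLB (range fun n => s - m n) 0 := by
  refine ⟨by rintro _ ⟨n, rfl⟩; exact zero_le, fun z hz => ?_⟩
  have h1 : s ≤ s - z := by
    refine h.2 ?_
    rintro _ ⟨n, rfl⟩
    rw [← inf_eq_right.2 (h.1 ⟨n, rfl⟩), ← sub_sub_eq_inf]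
    exact tsub_le_tsub_left (hz ⟨n, rfl⟩) s
  have h2 : z ≤ s := (hz ⟨0, rfl⟩).trans tsub_le_self
  rw [← inf_eq_right.2 h2, ← sub_sub_eq_inf, tsub_eq_zero_of_le h1]

theorem eventually_tendsto {m : ℕ → M} (hm : Monotone m) {s : M} (h : IsLUB (range m) s) :
    ∀ᶠ φ in generic M, Tendsto (fun n => φ.toFun (m n)) atTop (nhds (φ.toFun s)) := by
  have hd : Antitone fun n => s - m n := fun i j hij => tsub_le_tsub_left (hm hij) s
  filter_upwards [eventually_generic hd (isGLB_sub h)] with φ hφ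
  refine tendsto_atTop_isLUB (fun i j hij => φ.mono (hm hij)) ⟨?_, fun b hb => ?_⟩
  · rintro _ ⟨n, rfl⟩
    exact φ.mono (h.1 ⟨n, rfl⟩)
  · refine le_of_forall_pos_lt_add fun ε hε => ?_
    obtain ⟨n, hn⟩ := hφ ε hε
    rw [φ.sub_of_le (h.1 ⟨n, rfl⟩)] at hn
    have := hb ⟨n, rfl⟩
    linarith

/-- A left-continuous monotone family which is eventually `0` and eventually `⊤`. -/
structure BoundedResolution (M : Type*) [MVLattice M] where
  toFun : ℝ → M
  mono : Monotone toFun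
  isLUB : ∀ t, IsLUB (toFun '' Iio t) (toFun t)
  exists_zero : ∃ t, toFun t = 0
  exists_top : ∃ t, toFun t = ⊤

namespace BoundedResolution

variable (F : BoundedResolution M)

theorem monotone_comp (φ : PrimeState M) : Monotone fun t => φ.toFun (F.toFun t) :=
  fun _ _ h => φ.mono (F.mono h)

/-- The distribution of a resolution in a state. -/
noncomputable def law (φ : PrimeState M) : MeasureTheory.Measure ℝ :=
  (F.monotone_comp φ).stieltjesFunction.measure

theorem tendsto_atBot (φ : PrimeState M) :
    Tendsto (F.monotone_comp φ).stieltjesFunction atBot (nhds 0) := by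
  obtain ⟨K, hK⟩ := F.exists_zero
  refine tendsto_const_nhds.congr' ?_
  filter_upwards [eventually_lt_atBot K] with t ht
  rw [Monotone.stieltjesFunction_eq]
  refine le_antisymm ?_ ?_
  · exact (φ.nonneg _).trans ((F.monotone_comp φ).le_rightLim le_rfl)
  · refine ((F.monotone_comp φ).rightLim_le ht).trans ?_
    rw [hK, φ.map_zero]

theorem tendsto_atTop (φ : PrimeState M) :
    Tendsto (F.monotone_comp φ).stieltjesFunction atTop (nhds 1) := by
  obtain ⟨K, hK⟩ := F.exists_top
  refine tendsto_const_nhds.congr' ?_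
  filter_upwards [eventually_ge_atTop K] with t ht
  rw [Monotone.stieltjesFunction_eq]
  refine le_antisymm ?_ ?_
  · refine le_trans ?_ ((F.monotone_comp φ).le_rightLim ht)
    rw [hK, φ.top]
  · exact ((F.monotone_comp φ).rightLim_le (lt_add_one t)).trans (φ.le_one _)

instance (φ : PrimeState M) : MeasureTheory.IsProbabilityMeasure (F.law φ) :=
  StieltjesFunction.isProbabilityMeasure _ (F.tendsto_atBot φ) (F.tendsto_atTop φ)

/-- `m` is the value at `A` of the observable with resolution `F`. -/
def Represents (A : Set ℝ) (m : M) : Prop :=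
  ∀ᶠ φ in generic M, (F.law φ).real A = φ.toFun m

theorem isLUB_seq (t : ℝ) :
    IsLUB (range fun n : ℕ => F.toFun (t - 1 / ((n : ℝ) + 1))) (F.toFun t) := by
  refine ⟨?_, fun b hb => (F.isLUB t).2 ?_⟩
  · rintro _ ⟨n, rfl⟩
    exact F.mono (sub_le_self _ (by positivity))
  · rintro _ ⟨s, hs, rfl⟩
    obtain ⟨n, hn⟩ := exists_nat_one_div_lt (sub_pos.2 (mem_Iio.1 hs))
    exact (F.mono (by linarith)).trans (hb ⟨n, rfl⟩)

theorem represents_Iio (t : ℝ) : F.Represents (Iio t) (F.toFun t) := by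
  have hmono : Monotone fun n : ℕ => F.toFun (t - 1 / ((n : ℝ) + 1)) := fun i j hij =>
    F.mono (sub_le_sub_left (Nat.one_div_le_one_div hij) t)
  filter_upwards [eventually_tendsto hmono (F.isLUB_seq t)] with φ hφ
  have hseq : Tendsto (fun n : ℕ => t - 1 / ((n : ℝ) + 1)) atTop (nhdsWithin t (Iio t)) := by
    refine tendsto_nhdsWithin_iff.2 ⟨?_, Eventually.of_forall fun n => ?_⟩
    · simpa using (tendsto_const_nhds (x := t)).sub
        (tendsto_one_div_add_atTop_nhds_zero_nat (𝕜 := ℝ))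
    · exact sub_lt_self t (by positivity : (0 : ℝ) < 1 / ((n : ℝ) + 1))
  have h1 := tendsto_nhds_unique hφ (((F.monotone_comp φ).tendsto_leftLim t).comp hseq)
  have h2 : Function.leftLim (F.monotone_comp φ).stieltjesFunction t = φ.toFun (F.toFun t) := by
    rw [h1]
    have : ((F.monotone_comp φ).stieltjesFunction : ℝ → ℝ) =
        Function.rightLim fun t => φ.toFun (F.toFun t) := funext fun _ =>
      Monotone.stieltjesFunction_eq _ _
    rw [this]
    exact leftLim_rightLim ((F.monotone_comp φ).tendsto_leftLim t)
  rw [MeasureTheory.measureReal_def, law, StieltjesFunction.measure_Iio _ (F.tendsto_atBot φ), h2,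
    sub_zero, ENNReal.toReal_ofReal (φ.nonneg _)]

variable {F} {A B : Set ℝ} {a b : M}

theorem Represents.le (hsup : ∀ f : ℕ → M, ∃ s, IsLUB (range f) s) (hA : F.Represents A a)
    (hB : F.Represents B b) (h : A ⊆ B) : a ≤ b := by
  refine le_of_eventually hsup ?_
  filter_upwards [hA, hB] with φ h1 h2
  rw [← h1, ← h2]
  exact MeasureTheory.measureReal_mono h

theorem Represents.unique (hsup : ∀ f : ℕ → M, ∃ s, IsLUB (range f) s) (hA : F.Represents A a)
    (hB : F.Represents A b) : a = b :=
  le_antisymm (hA.le hsup hB subset_rfl) (hB.le hsup hA subset_rfl)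

theorem represents_univ (F : BoundedResolution M) : F.Represents univ ⊤ :=
  Eventually.of_forall fun φ => by rw [MeasureTheory.probReal_univ, φ.top]

theorem Represents.compl (hA : F.Represents A a) (hm : MeasurableSet A) :
    F.Represents Aᶜ (⊤ - a) := by
  filter_upwards [hA] with φ h
  rw [MeasureTheory.probReal_compl_eq_one_sub hm, φ.sub_of_le le_top, φ.top, h]

theorem Represents.le_top_sub (hsup : ∀ f : ℕ → M, ∃ s, IsLUB (range f) s)
    (hA : F.Represents A a) (hB : F.Represents B b) (hm : MeasurableSet B)
    (h : Disjoint A B) : a ≤ ⊤ - b :=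
  hA.le hsup (hB.compl hm) h.subset_compl_right

theorem Represents.union (hsup : ∀ f : ℕ → M, ∃ s, IsLUB (range f) s)
    (hA : F.Represents A a) (hB : F.Represents B b) (hm : MeasurableSet B)
    (h : Disjoint A B) : F.Represents (A ∪ B) (a + b) := by
  have hab := hA.le_top_sub hsup hB hm h
  filter_upwards [hA, hB] with φ h1 h2
  rw [MeasureTheory.measureReal_union h hm, φ.add _ _ hab, h1, h2]

theorem Represents.iUnion {A : ℕ → Set ℝ} {a : ℕ → M} {s : M} (hA : ∀ n, F.Represents (A n) (a n))
    (hmono : Monotone A) (ha : Monotone a) (hs : IsLUB (range a) s) :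
    F.Represents (⋃ n, A n) s := by
  filter_upwards [eventually_countable_forall.2 hA, eventually_tendsto ha hs] with φ h1 h2
  refine tendsto_nhds_unique ?_ h2
  simp only [← h1]
  exact (ENNReal.tendsto_toReal (MeasureTheory.measure_ne_top _ _)).comp
    (MeasureTheory.tendsto_measure_iUnion_atTop hmono)

theorem exists_represents (hsup : ∀ f : ℕ → M, ∃ s, IsLUB (range f) s)
    (F : BoundedResolution M) (A : Set ℝ) (hA : MeasurableSet A) : ∃ a, F.Represents A a := by
  refine MeasurableSpace.induction_on_inter (C := fun A _ => ∃ a, F.Represents A a)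
    (BorelSpace.measurable_eq.trans (borel_eq_generateFrom_Iio ℝ)) isPiSystem_Iio ?_ ?_ ?_ ?_ A hA
  · exact ⟨_, by simpa using F.represents_univ.compl MeasurableSet.univ⟩
  · rintro _ ⟨t, rfl⟩
    exact ⟨_, F.represents_Iio t⟩
  · rintro t ht ⟨a, ha⟩
    exact ⟨_, ha.compl ht⟩
  · intro f hdisj hf h
    have hacc : ∀ n, ∃ a, F.Represents (accumulate f n) a := by
      intro n
      induction n with
      | zero => simpa using h 0
      | succ n ih =>
        obtain ⟨a, ha⟩ := ih
        obtain ⟨b, hb⟩ := h (n + 1)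
        rw [accumulate_succ]
        exact ⟨_, ha.union hsup hb (hf _) (disjoint_accumulate hdisj n.lt_succ_self)⟩
    choose a ha using hacc
    obtain ⟨s, hs⟩ := hsup a
    refine ⟨s, ?_⟩
    rw [← iUnion_accumulate]
    exact Represents.iUnion ha monotone_accumulate
      (fun i j hij => (ha i).le hsup (ha j) (monotone_accumulate hij)) hs

theorem exists_measure (hsup : ∀ f : ℕ → M, ∃ s, IsLUB (range f) s) (F : BoundedResolution M) :
    ∃ x : Set ℝ → M, x univ = ⊤ ∧ (∀ t, x (Iio t) = F.toFun t) ∧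
      (∀ A B, MeasurableSet A → MeasurableSet B → Disjoint A B →
        x A ≤ ⊤ - x B ∧ x (A ∪ B) = x A + x B) ∧
      ∀ f : ℕ → Set ℝ, (∀ n, MeasurableSet (f n)) → Monotone f →
        IsLUB (range fun n => x (f n)) (x (⋃ n, f n)) := by
  classical
  choose x hx using exists_represents hsup F
  let X : Set ℝ → M := fun A => if h : MeasurableSet A then x A h else ⊤
  have hX : ∀ A, MeasurableSet A → F.Represents A (X A) := fun A hA => by
    simp only [X, dif_pos hA]; exact hx A hA
  refine ⟨X, ?_, fun t => ?_, fun A B hA hB h => ⟨?_, ?_⟩, fun f hf hmono => ?_⟩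
  · exact (hX _ MeasurableSet.univ).unique hsup F.represents_univ
  · exact (hX _ measurableSet_Iio).unique hsup (F.represents_Iio t)
  · exact (hX A hA).le_top_sub hsup (hX B hB) hB h
  · exact (hX _ (hA.union hB)).unique hsup ((hX A hA).union hsup (hX B hB) hB h)
  · obtain ⟨s, hs⟩ := hsup fun n => X (f n)
    have h1 : F.Represents (⋃ n, f n) s := Represents.iUnion (fun n => hX _ (hf n)) hmono
      (fun i j hij => (hX _ (hf i)).le hsup (hX _ (hf j)) (hmono hij)) hs
    rwa [(hX _ (MeasurableSet.iUnion hf)).unique hsup h1]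

end BoundedResolution

end MVLattice

/-- A complete lattice with a difference `a - b`, meaningful for `b ≤ a`: the complete lattice
effect algebras, presented through their difference. -/
class DiffLattice (L : Type*) extends CompleteLattice L, Sub L where
  sub_le_self' : ∀ {a b : L}, b ≤ a → a - b ≤ a
  sub_sub_self' : ∀ {a b : L}, b ≤ a → a - (a - b) = b
  sub_le_sub_left' : ∀ {a b c : L}, a ≤ b → b ≤ c → c - b ≤ c - a
  sub_sub_sub' : ∀ {a b c : L}, a ≤ b → b ≤ c → (c - a) - (c - b) = b - a

namespace DiffLattice

variable {L : Type*} [DiffLattice L] {a b c w x y : L}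

theorem sub_bot (a : L) : a - ⊥ = a := by
  refine le_antisymm (sub_le_self' bot_le) ?_
  conv_lhs => rw [← sub_sub_self' (le_refl a)]
  exact sub_le_sub_left' bot_le (sub_le_self' le_rfl)

theorem sub_self (a : L) : a - a = ⊥ := by
  conv_lhs => rw [← sub_bot a]
  rw [sub_bot a]
  simpa [sub_bot] using sub_sub_self' (bot_le : ⊥ ≤ a)

theorem sub_le_sub_left_iff (ha : a ≤ c) (hb : b ≤ c) : c - b ≤ c - a ↔ a ≤ b := by
  refine ⟨fun h => ?_, fun h => sub_le_sub_left' h hb⟩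
  have := sub_le_sub_left' h (sub_le_self' ha)
  rwa [sub_sub_self' ha, sub_sub_self' hb] at this

theorem le_sub_comm (hb : b ≤ c) (h : a ≤ c - b) : b ≤ c - a := by
  rw [← sub_sub_self' hb]
  exact sub_le_sub_left' h (sub_le_self' hb)

theorem sub_le_sub_right (hab : a ≤ b) (hbc : b ≤ c) : b - a ≤ c - a := by
  rw [← sub_sub_sub' hab hbc]
  exact sub_le_self' (sub_le_sub_left' hab hbc)

theorem sub_le_sub_right_iff (ha : w ≤ a) (hb : w ≤ b) : a - w ≤ b - w ↔ a ≤ b := by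
  rw [← sub_sub_sub' ha le_top, ← sub_sub_sub' hb le_top,
    sub_le_sub_left_iff (sub_le_sub_left' hb le_top) (sub_le_sub_left' ha le_top),
    sub_le_sub_left_iff le_top le_top]

theorem sub_left_injective (ha : w ≤ a) (hb : w ≤ b) (h : a - w = b - w) : a = b :=
  le_antisymm ((sub_le_sub_right_iff ha hb).1 h.le) ((sub_le_sub_right_iff hb ha).1 h.ge)

theorem sub_right_comm (ha : a ≤ c) (hx : x ≤ c - a) : (c - a) - x = (c - x) - a := by
  have hxc : x ≤ c := hx.trans (sub_le_self' ha)
  have h := sub_sub_sub' (le_sub_comm ha hx) (sub_le_self' hxc)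
  rwa [sub_sub_self' hxc] at h

theorem sub_sub_sub_right (hwa : w ≤ a) (hab : a ≤ b) : (b - w) - (a - w) = b - a := by
  rw [← sub_sub_sub' hwa hab, sub_sub_self' (sub_le_sub_left' hwa hab)]

theorem exists_sub_eq (hw : w ≤ c) (hx : x ≤ c - w) : ∃ u, w ≤ u ∧ u ≤ c ∧ u - w = x := by
  have h1 : (c - w) - x ≤ c - w := sub_le_self' hx
  have h2 : (c - w) - x ≤ c := h1.trans (sub_le_self' hw)
  have h3 : w ≤ c - ((c - w) - x) := le_sub_comm hw h1
  refine ⟨c - ((c - w) - x), h3, sub_le_self' h2, ?_⟩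
  rw [← sub_sub_sub' h3 (sub_le_self' h2), sub_sub_self' h2, sub_sub_self' hx]

theorem sub_sup (ha : a ≤ c) (hb : b ≤ c) : c - (a ⊔ b) = (c - a) ⊓ (c - b) := by
  refine le_antisymm (le_inf (sub_le_sub_left' le_sup_left (sup_le ha hb))
    (sub_le_sub_left' le_sup_right (sup_le ha hb))) ?_
  have h : (c - a) ⊓ (c - b) ≤ c := inf_le_left.trans (sub_le_self' ha)
  exact le_sub_comm h
    (sup_le (le_sub_comm ha inf_le_left) (le_sub_comm hb inf_le_right))

theorem top_sub_top_sub (a : L) : ⊤ - (⊤ - a) = a := sub_sub_self' le_top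

theorem top_sub_inf (a b : L) : ⊤ - (a ⊓ b) = (⊤ - a) ⊔ (⊤ - b) := by
  rw [← top_sub_top_sub ((⊤ - a) ⊔ (⊤ - b)), sub_sup le_top le_top, top_sub_top_sub,
    top_sub_top_sub]

theorem sup_sub (ha : w ≤ a) (hb : w ≤ b) : (a ⊔ b) - w = (a - w) ⊔ (b - w) := by
  refine le_antisymm ?_ (sup_le (sub_le_sub_right ha le_sup_left)
    (sub_le_sub_right hb le_sup_right))
  obtain ⟨u, hu, -, h⟩ := exists_sub_eq (le_top : w ≤ ⊤)
    (sup_le (sub_le_sub_right ha le_top) (sub_le_sub_right hb le_top))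
  rw [← h, sub_le_sub_right_iff (ha.trans le_sup_left) hu]
  refine sup_le ?_ ?_
  · rw [← sub_le_sub_right_iff ha hu, h]; exact le_sup_left
  · rw [← sub_le_sub_right_iff hb hu, h]; exact le_sup_right

/-- Compatibility of two elements. -/
def Compat (a b : L) : Prop := (a ⊔ b) - b = a - (a ⊓ b)

theorem Compat.symm (h : Compat a b) : Compat b a := by
  unfold Compat at *
  rw [sup_comm, inf_comm, ← sub_sub_sub_right (inf_le_left : a ⊓ b ≤ a) le_sup_left, ← h,
    sub_sub_sub' inf_le_right le_sup_right]

theorem Compat.of_le (h : a ≤ b) : Compat a b := by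
  unfold Compat
  rw [sup_eq_right.2 h, inf_eq_left.2 h, sub_self, sub_self]

theorem Compat.of_sub_eq {v : L} (hwa : w ≤ a) (hwb : w ≤ b) (hbv : b ≤ v)
    (h : a - w = v - b) : Compat a b := by
  have hav : a ≤ v := by
    rw [← sub_le_sub_right_iff hwa (hwb.trans hbv), h]
    exact sub_le_sub_left' hwb hbv
  have hva : v - a = b - w := by
    rw [← sub_sub_sub_right hwa hav, h, sub_sub_sub' hwb hbv]
  have hj : a ⊔ b ≤ v := sup_le hav hbv
  have hda : v - (a ⊔ b) ≤ a - w := by rw [h]; exact sub_le_sub_left' le_sup_right hj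
  have hdb : v - (a ⊔ b) ≤ b - w := by rw [← hva]; exact sub_le_sub_left' le_sup_left hj
  obtain ⟨m, hwm, hma, hm⟩ := exists_sub_eq hwa hda
  have hmb : m ≤ b := by rwa [← sub_le_sub_right_iff hwm hwb, hm]
  have h1 : a - m = (a ⊔ b) - b := by
    rw [← sub_sub_sub_right hwm hma, hm, h, sub_sub_sub' le_sup_right hj]
  have h2 : b - m = (a ⊔ b) - a := by
    rw [← sub_sub_sub_right hwm hmb, hm, ← hva, sub_sub_sub' le_sup_left hj]
  have hmi : m ≤ a ⊓ b := le_inf hma hmb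
  have h3 : (a ⊓ b) - m = m - m := by
    rw [sub_self, ← le_bot_iff, ← sub_self (a ⊔ b), sub_sup le_sup_left le_sup_right]
    refine le_inf ?_ ?_
    · rw [← h2]; exact sub_le_sub_right hmi inf_le_right
    · rw [← h1]; exact sub_le_sub_right hmi inf_le_left
  unfold Compat
  rw [sub_left_injective hmi le_rfl h3, h1]

theorem Compat.top_sub (h : Compat a b) : Compat (⊤ - a) b := by
  have hs : (b ⊔ a) - a = b - (b ⊓ a) := h.symm
  have hle : a - (a ⊓ b) ≤ a := sub_le_self' inf_le_left
  refine (of_sub_eq (w := b - (b ⊓ a)) (v := ⊤ - (a - (a ⊓ b))) (sub_le_self' inf_le_left)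
    ?_ (sub_le_sub_left' hle le_top) ?_).symm
  · rw [← hs]; exact sub_le_sub_right le_sup_right le_top
  · rw [sub_sub_self' inf_le_left, sub_sub_sub' hle le_top, sub_sub_self' inf_le_left, inf_comm]

theorem Compat.sSup_right {S : Set L} (h : ∀ b ∈ S, Compat a b) : Compat a (sSup S) := by
  set w := sSup ((fun b => a ⊓ b) '' S) with hw
  have hwa : w ≤ a := sSup_le (by rintro _ ⟨b, -, rfl⟩; exact inf_le_left)
  have hwb : w ≤ sSup S := sSup_le (by
    rintro _ ⟨b, hb, rfl⟩; exact inf_le_right.trans (le_sSup hb))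
  have hle : a - w ≤ (a ⊔ sSup S) - sSup S := by
    have h0 : a - w ≤ a ⊔ sSup S := (sub_le_self' hwa).trans le_sup_left
    refine le_sub_comm h0 (sSup_le fun b hb => ?_)
    have hbS : b ≤ a ⊔ sSup S := (le_sSup hb).trans le_sup_right
    refine le_sub_comm hbS ?_
    calc a - w ≤ a - (a ⊓ b) := sub_le_sub_left' (le_sSup ⟨b, hb, rfl⟩) hwa
      _ = (a ⊔ b) - b := Eq.symm (h b hb)
      _ ≤ (a ⊔ sSup S) - b := sub_le_sub_right le_sup_right (sup_le le_sup_left hbS)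
  obtain ⟨u, hu, -, huw⟩ := exists_sub_eq le_sup_right hle
  exact of_sub_eq hwa hwb hu huw.symm

theorem Compat.sub (hxa : x ≤ a) (ha : Compat a c) (hx : Compat x c) : Compat (a - x) c := by
  have hα : a ⊓ c ≤ a := inf_le_left
  have hξx : x ⊓ c ≤ x := inf_le_left
  have hξα : x ⊓ c ≤ a ⊓ c := inf_le_inf_right _ hxa
  have hξa : x ⊓ c ≤ a := hξα.trans hα
  have hq : x - (x ⊓ c) ≤ a - (a ⊓ c) := by
    rw [← show _ = _ from ha, ← show _ = _ from hx]
    exact sub_le_sub_right le_sup_right (sup_le_sup_right hxa _)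
  have hp : (a ⊓ c) - (x ⊓ c) ≤ a - (x ⊓ c) := sub_le_sub_right hξα hα
  have hqp : x - (x ⊓ c) ≤ (a - (x ⊓ c)) - ((a ⊓ c) - (x ⊓ c)) := by
    rwa [sub_sub_sub_right hξα hα]
  have hxξ : x - (x ⊓ c) ≤ a - (x ⊓ c) := sub_le_sub_right hξx hxa
  have hpq : (a ⊓ c) - (x ⊓ c) ≤ a - x := by
    rw [← sub_sub_sub_right hξx hxa]
    exact le_sub_comm hp hqp
  have heq : (a - x) - ((a ⊓ c) - (x ⊓ c)) = (a - (a ⊓ c)) - (x - (x ⊓ c)) := by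
    rw [← sub_sub_sub_right hξx hxa, ← sub_sub_sub_right hξα hα, ← sub_right_comm hp hqp]
  have hle : (a - x) - ((a ⊓ c) - (x ⊓ c)) ≤ ⊤ - c := by
    rw [heq]
    refine (sub_le_self' hq).trans ?_
    rw [← show _ = _ from ha]
    exact sub_le_sub_right le_sup_right le_top
  obtain ⟨v, hv, -, hvc⟩ := exists_sub_eq le_top hle
  exact of_sub_eq hpq ((sub_le_self' hξα).trans inf_le_right) hv hvc.symm

/-- A maximal set of pairwise compatible elements. -/
structure IsBlock (S : Set L) : Prop where
  compat : ∀ {a b}, a ∈ S → b ∈ S → Compat a b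
  mem_of_compat : ∀ {c}, (∀ a ∈ S, Compat c a) → c ∈ S

theorem exists_isBlock {C : Set L} (hC : IsChain (· ≤ ·) C) : ∃ S, C ⊆ S ∧ IsBlock S := by
  obtain ⟨S, hCS, hS⟩ := zorn_subset_nonempty {S : Set L | ∀ a ∈ S, ∀ b ∈ S, Compat a b} (by
    intro c hc hchain _
    refine ⟨⋃₀ c, ?_, fun s hs => Set.subset_sUnion_of_mem hs⟩
    rintro a ⟨s, hs, ha⟩ b ⟨t, ht, hb⟩
    rcases hchain.total hs ht with h | h
    · exact hc ht a (h ha) b hb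
    · exact hc hs a ha b (h hb)) C (by
    intro a ha b hb
    rcases hC.total ha hb with h | h
    · exact Compat.of_le h
    · exact (Compat.of_le h).symm)
  refine ⟨S, hCS, fun ha hb => hS.prop _ ha _ hb, fun {c} hc => ?_⟩
  have hins : insert c S ∈ {S : Set L | ∀ a ∈ S, ∀ b ∈ S, Compat a b} := by
    rintro a (rfl | ha) b (rfl | hb)
    · exact Compat.of_le le_rfl
    · exact hc b hb
    · exact (hc a ha).symm
    · exact hS.prop a ha b hb
  exact hS.le_of_ge hins (Set.subset_insert _ _) (Set.mem_insert _ _)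

namespace IsBlock

variable {S : Set L}

theorem sSup_mem (hS : IsBlock S) {T : Set L} (hT : T ⊆ S) : sSup T ∈ S :=
  hS.mem_of_compat fun _ ha => (Compat.sSup_right fun _ hb => hS.compat ha (hT hb)).symm

theorem top_sub_mem (hS : IsBlock S) (ha : a ∈ S) : ⊤ - a ∈ S :=
  hS.mem_of_compat fun _ hb => (hS.compat ha hb).top_sub

theorem sup_mem (hS : IsBlock S) (ha : a ∈ S) (hb : b ∈ S) : a ⊔ b ∈ S := by
  rw [← sSup_pair]
  exact hS.sSup_mem (Set.pair_subset ha hb)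

theorem inf_mem (hS : IsBlock S) (ha : a ∈ S) (hb : b ∈ S) : a ⊓ b ∈ S := by
  rw [← top_sub_top_sub (a ⊓ b), top_sub_inf]
  exact hS.top_sub_mem (hS.sup_mem (hS.top_sub_mem ha) (hS.top_sub_mem hb))

theorem sub_mem (hS : IsBlock S) (hxa : x ≤ a) (ha : a ∈ S) (hx : x ∈ S) : a - x ∈ S :=
  hS.mem_of_compat fun _ hb => Compat.sub hxa (hS.compat ha hb) (hS.compat hx hb)

theorem bot_mem (hS : IsBlock S) : ⊥ ∈ S :=
  hS.mem_of_compat fun _ _ => Compat.of_le bot_le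

theorem top_mem (hS : IsBlock S) : ⊤ ∈ S :=
  hS.mem_of_compat fun _ _ => (Compat.of_le le_top).symm

end IsBlock

/-- Truncated difference. -/
def tdiff (a b : L) : L := a - (a ⊓ b)

theorem tdiff_of_le (h : b ≤ a) : tdiff a b = a - b := by rw [tdiff, inf_eq_right.2 h]

theorem tdiff_le (a b : L) : tdiff a b ≤ a := sub_le_self' inf_le_left

theorem Compat.tdiff_eq (h : Compat a b) : tdiff a b = (a ⊔ b) - b := Eq.symm h

theorem Compat.tdiff_le_top_sub (h : Compat a b) : tdiff a b ≤ ⊤ - b := by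
  rw [h.tdiff_eq]
  exact sub_le_sub_right le_sup_right le_top

theorem tdiff_mono (ha : Compat a c) (hb : Compat b c) (h : a ≤ b) : tdiff a c ≤ tdiff b c := by
  rw [ha.tdiff_eq, hb.tdiff_eq]
  exact sub_le_sub_right le_sup_right (sup_le_sup_right h _)

/-- Truncated sum. -/
def tsum (a b : L) : L := ⊤ - tdiff (⊤ - a) b

theorem tsum_comm (h : Compat a b) : tsum a b = tsum b a := by
  have h1 : tdiff (⊤ - b) a = (⊤ - b) ⊔ a - a := h.symm.top_sub.tdiff_eq
  unfold tsum
  rw [h1]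
  congr 1
  unfold tdiff
  rw [← sub_sub_sub' (inf_le_left : (⊤ - a) ⊓ b ≤ ⊤ - a) le_top, top_sub_inf, top_sub_top_sub,
    sup_comm]

theorem le_tsum (a b : L) : a ≤ tsum a b :=
  le_sub_comm le_top (tdiff_le _ _)

theorem tsum_tdiff (h : a ≤ b) : tsum a (tdiff b a) = b := by
  have h1 : b - a ≤ ⊤ - a := sub_le_sub_right h le_top
  rw [tsum, tdiff_of_le h, tdiff_of_le h1, sub_sub_sub_right h le_top, top_sub_top_sub]

theorem tdiff_tdiff (a b : L) : tdiff a (tdiff a b) = a ⊓ b := by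
  rw [tdiff_of_le (tdiff_le a b), tdiff, sub_sub_self' inf_le_left]

theorem tdiff_top_sub_le (hab : Compat a b) (hcb : Compat c b) (hdb : Compat (tdiff a b) b)
    (h : tdiff a b ≤ c) : tdiff (⊤ - c) b ≤ ⊤ - a := by
  refine (tdiff_mono hcb.top_sub hdb.top_sub (sub_le_sub_left' h le_top)).trans ?_
  have h1 : b ≤ ⊤ - tdiff a b := le_sub_comm le_top hab.tdiff_le_top_sub
  rw [tdiff_of_le h1, ← sub_right_comm le_top hab.tdiff_le_top_sub, hab.tdiff_eq,
    sub_sub_sub_right le_sup_right le_top]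
  exact sub_le_sub_left' le_sup_left le_top

theorem tdiff_le_iff (hab : Compat a b) (hcb : Compat c b) (hdb : Compat (tdiff a b) b)
    (heb : Compat (tdiff (⊤ - c) b) b) : tdiff a b ≤ c ↔ a ≤ tsum c b := by
  refine ⟨fun h => ?_, fun h => ?_⟩
  · exact le_sub_comm le_top (tdiff_top_sub_le hab hcb hdb h)
  · have := tdiff_top_sub_le hcb.top_sub hab.top_sub heb (le_sub_comm le_top h)
    rwa [top_sub_top_sub, top_sub_top_sub] at this

theorem tdiff_tdiff_eq (hxy : Compat x y) (hd : Compat (tdiff x y) (tdiff (⊤ - y) (tdiff (⊤ - y) c)))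
    (hs : Compat x (tsum y c)) : tdiff (tdiff x y) c = tdiff x (tsum y c) := by
  rw [tdiff_tdiff] at hd
  have h1 : tdiff (tdiff x y) c = tdiff (tdiff x y) ((⊤ - y) ⊓ c) := by
    change _ - (tdiff x y ⊓ c) = _ - (tdiff x y ⊓ ((⊤ - y) ⊓ c))
    rw [← inf_assoc, inf_eq_left.2 hxy.tdiff_le_top_sub]
  have hys : y ≤ tsum y c := le_tsum y c
  have h2 : tsum y c - y = (⊤ - y) ⊓ c := by
    rw [← sub_sub_sub' hys le_top, tsum, top_sub_top_sub, tdiff, sub_sub_self' inf_le_left]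
  rw [h1, hd.tdiff_eq, ← h2, hxy.tdiff_eq, ← sup_sub le_sup_right hys,
    sub_sub_sub_right hys le_sup_right, hs.tdiff_eq, sup_assoc, sup_eq_right.2 hys]

namespace IsBlock

variable {S : Set L}

theorem tdiff_mem (hS : IsBlock S) (ha : a ∈ S) (hb : b ∈ S) : tdiff a b ∈ S :=
  hS.sub_mem inf_le_left ha (hS.inf_mem ha hb)

theorem tsum_mem (hS : IsBlock S) (ha : a ∈ S) (hb : b ∈ S) : tsum a b ∈ S :=
  hS.top_sub_mem (hS.tdiff_mem (hS.top_sub_mem ha) hb)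

theorem tdiff_le_iff (hS : IsBlock S) (ha : a ∈ S) (hb : b ∈ S) (hc : c ∈ S) :
    tdiff a b ≤ c ↔ a ≤ tsum c b :=
  DiffLattice.tdiff_le_iff (hS.compat ha hb) (hS.compat hc hb)
    (hS.compat (hS.tdiff_mem ha hb) hb) (hS.compat (hS.tdiff_mem (hS.top_sub_mem hc) hb) hb)

theorem tdiff_tdiff_eq (hS : IsBlock S) (hx : x ∈ S) (hy : y ∈ S) (hc : c ∈ S) :
    tdiff (tdiff x y) c = tdiff x (tsum y c) :=
  DiffLattice.tdiff_tdiff_eq (hS.compat hx hy)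
    (hS.compat (hS.tdiff_mem hx hy)
      (hS.tdiff_mem (hS.top_sub_mem hy) (hS.tdiff_mem (hS.top_sub_mem hy) hc)))
    (hS.compat hx (hS.tsum_mem hy hc))

theorem tsum_right_comm (hS : IsBlock S) (ha : a ∈ S) (hb : b ∈ S) (hc : c ∈ S) :
    tsum a (tsum b c) = tsum (tsum a c) b := by
  have h : ∀ z ∈ S, z ≤ tsum a (tsum b c) ↔ z ≤ tsum (tsum a c) b := fun z hz => by
    rw [← hS.tdiff_le_iff hz (hS.tsum_mem hb hc) ha, ← hS.tdiff_tdiff_eq hz hb hc,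
      hS.tdiff_le_iff (hS.tdiff_mem hz hb) hc ha, hS.tdiff_le_iff hz hb (hS.tsum_mem ha hc)]
  exact le_antisymm ((h _ (hS.tsum_mem ha (hS.tsum_mem hb hc))).1 le_rfl)
    ((h _ (hS.tsum_mem (hS.tsum_mem ha hc) hb)).2 le_rfl)

theorem tsum_assoc (hS : IsBlock S) (ha : a ∈ S) (hb : b ∈ S) (hc : c ∈ S) :
    tsum (tsum a b) c = tsum a (tsum b c) := by
  rw [← hS.tsum_right_comm ha hc hb, tsum_comm (hS.compat hc hb)]

theorem tsum_bot (a : L) : tsum a ⊥ = a := by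
  rw [tsum, tdiff_of_le bot_le, sub_bot, top_sub_top_sub]

/-- A block, as a sublattice. -/
def toSublattice (hS : IsBlock S) : Sublattice L where
  carrier := S
  supClosed' := fun _ ha _ hb => hS.sup_mem ha hb
  infClosed' := fun _ ha _ hb => hS.inf_mem ha hb

/-- Blocks of a complete lattice effect algebra are MV-algebras. -/
@[reducible]
def toMVLattice (hS : IsBlock S) : MVLattice hS.toSublattice where
  top := ⟨⊤, hS.top_mem⟩
  le_top _ := (le_top : _ ≤ (⊤ : L))
  add a b := ⟨tsum a.1 b.1, hS.tsum_mem a.2 b.2⟩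
  sub a b := ⟨tdiff a.1 b.1, hS.tdiff_mem a.2 b.2⟩
  zero := ⟨⊥, hS.bot_mem⟩
  add_assoc a b c := Subtype.ext (hS.tsum_assoc a.2 b.2 c.2)
  add_comm a b := Subtype.ext (tsum_comm (hS.compat a.2 b.2))
  add_zero a := Subtype.ext (tsum_bot a.1)
  zero_add a := Subtype.ext ((tsum_comm (hS.compat hS.bot_mem a.2)).trans (tsum_bot a.1))
  nsmul := @nsmulRec _ ⟨⟨⊥, hS.bot_mem⟩⟩ ⟨fun a b => ⟨tsum a.1 b.1, hS.tsum_mem a.2 b.2⟩⟩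
  tsub_le a b c := hS.tdiff_le_iff a.2 b.2 c.2
  le_add_right' a b := le_tsum a.1 b.1
  add_tsub' _ _ h := Subtype.ext (tsum_tdiff h).symm
  sub_sub_eq_inf a b := Subtype.ext (tdiff_tdiff a.1 b.1)

theorem isLUB_coe (hS : IsBlock S) {ι : Type*} {f : ι → hS.toSublattice} {s : hS.toSublattice} :
    IsLUB (Set.range f) s ↔ IsLUB (Set.range fun i => (f i : L)) s := by
  refine ⟨fun h => ?_, fun h => ⟨?_, fun b hb => h.2 ?_⟩⟩
  · have hmem : sSup (Set.range fun i => (f i : L)) ∈ S :=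
      hS.sSup_mem (by rintro _ ⟨i, rfl⟩; exact (f i).2)
    have hs : (s : L) = sSup (Set.range fun i => (f i : L)) := by
      refine le_antisymm ?_ (sSup_le ?_)
      · have h1 : s ≤ ⟨_, hmem⟩ := h.2 (by
          rintro _ ⟨i, rfl⟩
          exact le_sSup (Set.mem_range_self (f := fun i => (f i : L)) i))
        exact h1
      · rintro _ ⟨i, rfl⟩
        exact h.1 ⟨i, rfl⟩
    rw [hs]
    exact isLUB_sSup _
  · rintro _ ⟨i, rfl⟩
    exact h.1 ⟨i, rfl⟩
  · rintro _ ⟨i, rfl⟩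
    exact hb ⟨i, rfl⟩

theorem exists_isLUB (hS : IsBlock S) {ι : Type*} (f : ι → hS.toSublattice) :
    ∃ s, IsLUB (Set.range f) s :=
  ⟨⟨sSup (Set.range fun i => (f i : L)), hS.sSup_mem (by rintro _ ⟨i, rfl⟩; exact (f i).2)⟩,
    hS.isLUB_coe.2 (isLUB_sSup _)⟩

end IsBlock

/-- A bounded left-continuous monotone family extends to a `σ`-additive map on the Borel sets. -/
theorem exists_measure {F : ℝ → L} (hmono : Monotone F)
    (hlub : ∀ t, IsLUB (F '' Set.Iio t) (F t)) (hbot : ∃ t, F t = ⊥) (htop : ∃ t, F t = ⊤) :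
    ∃ x : Set ℝ → L, x Set.univ = ⊤ ∧ (∀ t, x (Set.Iio t) = F t) ∧
      (∀ A B, MeasurableSet A → MeasurableSet B → Disjoint A B →
        x B ≤ x (A ∪ B) ∧ x (A ∪ B) - x B = x A) ∧
      ∀ f : ℕ → Set ℝ, (∀ n, MeasurableSet (f n)) → Monotone f →
        IsLUB (Set.range fun n => x (f n)) (x (⋃ n, f n)) := by
  obtain ⟨S, hFS, hS⟩ := exists_isBlock (C := Set.range F) hmono.isChain_range
  let _ := hS.toMVLattice
  let G : MVLattice.BoundedResolution hS.toSublattice :=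
    { toFun := fun t => ⟨F t, hFS ⟨t, rfl⟩⟩
      mono := fun _ _ h => hmono h
      isLUB := fun t => by
        rw [Set.image_eq_range, hS.isLUB_coe, ← Set.image_eq_range F (Set.Iio t)]
        exact hlub t
      exists_zero := hbot.imp fun t ht => Subtype.ext ht
      exists_top := htop.imp fun t ht => Subtype.ext ht }
  obtain ⟨x, h1, h2, h3, h4⟩ := G.exists_measure fun f => hS.exists_isLUB f
  refine ⟨fun A => x A, congrArg Subtype.val h1, fun t => congrArg Subtype.val (h2 t),
    fun A B hA hB h => ?_, fun f hf hm => hS.isLUB_coe.1 (h4 f hf hm)⟩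
  obtain ⟨h5, h6⟩ := h3 A B hA hB h
  have hle : x B ≤ x (A ∪ B) := h6 ▸ le_add_self
  refine ⟨hle, ?_⟩
  have h7 := congrArg Subtype.val (MVLattice.add_sub_self_of_le h5)
  rw [← h6] at h7
  exact (tdiff_of_le (a := (x (A ∪ B) : L)) hle).symm.trans h7

end DiffLattice

namespace EffectAlgebra

variable {E : Type*} (EA : EffectAlgebra E) {a b c d e : E}

theorem exists_add_right (h1 : EA.add a b = some d) (h2 : EA.add d c = some e) :
    ∃ f, EA.add b c = some f ∧ EA.add a f = some e := by
  have h := EA.assoc a b c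
  rw [h1, Option.bind_some, h2] at h
  exact Option.bind_eq_some_iff.1 h.symm

theorem exists_add_left (h1 : EA.add b c = some d) (h2 : EA.add a d = some e) :
    ∃ f, EA.add a b = some f ∧ EA.add f c = some e := by
  have h := EA.assoc a b c
  rw [h1, Option.bind_some, h2] at h
  exact Option.bind_eq_some_iff.1 h

theorem zero_add_one : EA.add EA.zero EA.one = some EA.one := by
  obtain ⟨b, hb⟩ := (EA.orth EA.one).exists
  rw [EA.comm] at hb
  have := EA.pos_one _ _ hb
  rwa [this] at hb

theorem zero_add (a : E) : EA.add EA.zero a = some a := by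
  obtain ⟨b, hb⟩ := (EA.orth a).exists
  obtain ⟨d, hd, hdb⟩ := EA.exists_add_left hb EA.zero_add_one
  rw [EA.comm] at hb hdb
  rw [hd, (EA.orth b).unique hdb hb]

theorem add_left_cancel (h1 : EA.add a b = some d) (h2 : EA.add a c = some d) : b = c := by
  obtain ⟨e, he⟩ := (EA.orth d).exists
  rw [EA.comm] at h1 h2
  obtain ⟨f, hf, h3⟩ := EA.exists_add_right h1 he
  obtain ⟨g, hg, h4⟩ := EA.exists_add_right h2 he
  obtain rfl : f = g := Option.some_injective _ (hf.symm.trans hg)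
  rw [EA.comm] at h3 h4
  exact (EA.orth f).unique h3 h4

theorem eq_zero_of_add (h : EA.add a b = some EA.zero) : b = EA.zero := by
  obtain ⟨f, hf, -⟩ := EA.exists_add_right h EA.zero_add_one
  exact EA.pos_one _ _ hf

theorem le_refl (a : E) : EA.le a a := ⟨EA.zero, by rw [EA.comm]; exact EA.zero_add a⟩

theorem zero_le (a : E) : EA.le EA.zero a := ⟨a, EA.zero_add a⟩

theorem le_one (a : E) : EA.le a EA.one := (EA.orth a).exists

variable {EA}

theorem le.trans (h1 : EA.le a b) (h2 : EA.le b c) : EA.le a c := by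
  obtain ⟨d, hd⟩ := h1
  obtain ⟨e, he⟩ := h2
  obtain ⟨f, -, hf⟩ := EA.exists_add_right hd he
  exact ⟨f, hf⟩

theorem le.antisymm (h1 : EA.le a b) (h2 : EA.le b a) : a = b := by
  obtain ⟨d, hd⟩ := h1
  obtain ⟨e, he⟩ := h2
  obtain ⟨f, hf, haf⟩ := EA.exists_add_right hd he
  have ha := EA.zero_add a
  rw [EA.comm] at ha
  obtain rfl : f = EA.zero := EA.add_left_cancel haf ha
  rw [EA.comm] at hf
  rw [EA.eq_zero_of_add hf, ha] at hd
  exact Option.some_injective _ hd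

theorem IsSup.unique {S : Set E} (h1 : EA.IsSup S a) (h2 : EA.IsSup S b) : a = b :=
  (h1.2 _ h2.1).antisymm (h2.2 _ h1.1)

open Classical in
/-- The difference of an effect algebra, extended to a total operation. -/
noncomputable def diff (EA : EffectAlgebra E) (a b : E) : E :=
  if h : EA.le b a then h.choose else a

theorem add_diff (h : EA.le b a) : EA.add b (EA.diff a b) = some a := by
  rw [diff, dif_pos h]
  exact h.choose_spec

theorem diff_eq (h : EA.add b c = some a) : EA.diff a b = c :=
  EA.add_left_cancel (add_diff ⟨c, h⟩) h

theorem diff_add_diff (h1 : EA.le a b) (h2 : EA.le b c) :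
    EA.add (EA.diff c b) (EA.diff b a) = some (EA.diff c a) := by
  obtain ⟨f, hf, haf⟩ := EA.exists_add_right (add_diff h1) (add_diff h2)
  rw [diff_eq haf, EA.comm, hf]

/-- The order of an effect algebra. -/
@[reducible]
def toPartialOrder (EA : EffectAlgebra E) : PartialOrder E where
  le := EA.le
  le_refl := EA.le_refl
  le_trans _ _ _ := le.trans
  le_antisymm _ _ := le.antisymm

/-- The complete lattice underlying a complete lattice effect algebra. -/
@[reducible]
noncomputable def toCompleteLattice (EA : EffectAlgebra E) (hE : EA.CompleteEA) :
    CompleteLattice E :=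
  letI := EA.toPartialOrder
  letI : SupSet E := ⟨fun S => (hE.1 S).choose⟩
  completeLatticeOfSup E fun S => (hE.1 S).choose_spec

/-- A complete lattice effect algebra as a complete lattice with a difference. -/
@[reducible]
noncomputable def toDiffLattice (EA : EffectAlgebra E) (hE : EA.CompleteEA) : DiffLattice E :=
  { EA.toCompleteLattice hE with
    sub := EA.diff
    sub_le_self' := fun {a b} h => ⟨b, by rw [EA.comm]; exact add_diff h⟩
    sub_sub_self' := fun h => diff_eq (by rw [EA.comm]; exact add_diff h)
    sub_le_sub_left' := fun h1 h2 => ⟨_, diff_add_diff h1 h2⟩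
    sub_sub_sub' := fun h1 h2 => diff_eq (diff_add_diff h1 h2) }

/-- In a complete lattice effect algebra, every bounded left-continuous monotone family is the
spectral resolution of an observable. -/
theorem exists_observable (hE : EA.CompleteEA) {F : ℝ → E}
    (hmono : ∀ s t, s ≤ t → EA.le (F s) (F t)) (hsup : ∀ t, EA.IsSup (F '' Set.Iio t) (F t))
    (hzero : ∃ t, F t = EA.zero) (hone : ∃ t, F t = EA.one) :
    ∃ x : Observable EA, ∀ t, x.toFun (bIio t) = F t := by
  let _ := EA.toDiffLattice hE
  have hbot : (⊥ : E) = EA.zero := le.antisymm (bot_le : (⊥ : E) ≤ EA.zero) (EA.zero_le _)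
  have htop : (⊤ : E) = EA.one := le.antisymm (EA.le_one _) (le_top : EA.one ≤ (⊤ : E))
  obtain ⟨x, h1, h2, h3, h4⟩ := DiffLattice.exists_measure (F := F) (fun s t => hmono s t) hsup
    (hbot ▸ hzero) (htop ▸ hone)
  refine ⟨⟨fun A => x A.1, h1.trans htop, fun A B h => ?_, fun f hf => ?_⟩, h2⟩
  · obtain ⟨hle, h⟩ := h3 A.1 B.1 A.2 B.2 h
    have h5 : EA.add (x B.1) (x (A.1 ∪ B.1) - x B.1) = some (x (A.1 ∪ B.1)) := add_diff hle
    rw [EA.comm, ← h]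
    exact h5
  · exact h4 (fun n => (f n).1) (fun n => (f n).2) (monotone_nat_of_le_succ hf)

end EffectAlgebra

namespace Observable

open Set

variable {E : Type*} {EA : EffectAlgebra E} {x y : Observable EA}

theorem mono (x : Observable EA) {A B : BorelSet} (h : A.1 ⊆ B.1) :
    EA.le (x.toFun A) (x.toFun B) := by
  refine ⟨x.toFun ⟨B.1 \ A.1, B.2.diff A.2⟩, ?_⟩
  rw [x.additive A ⟨B.1 \ A.1, _⟩ disjoint_sdiff_right]
  congr 2
  exact Subtype.ext (union_sdiff_cancel h)

theorem le_of_forall_lt (x : Observable EA) {t : ℝ} {b : E}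
    (h : ∀ s < t, EA.le (x.toFun (bIio s)) b) : EA.le (x.toFun (bIio t)) b := by
  have hsup := x.sup_cont (fun n : ℕ => bIio (t - 1 / ((n : ℝ) + 1))) fun n =>
    Iio_subset_Iio (sub_le_sub_left (Nat.one_div_le_one_div n.le_succ) t)
  have heq : (⟨⋃ n : ℕ, (bIio (t - 1 / ((n : ℝ) + 1))).1,
      MeasurableSet.iUnion fun n => (bIio (t - 1 / ((n : ℝ) + 1))).2⟩ : BorelSet) = bIio t := by
    refine Subtype.ext (Subset.antisymm (iUnion_subset fun n => ?_) fun s hs => ?_)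
    · exact Iio_subset_Iio (sub_le_self t (by positivity))
    · obtain ⟨n, hn⟩ := exists_nat_one_div_lt (sub_pos.2 (mem_Iio.1 hs))
      refine mem_iUnion.2 ⟨n, ?_⟩
      change s < t - 1 / ((n : ℝ) + 1)
      linarith
  rw [heq] at hsup
  refine hsup.2 b ?_
  rintro _ ⟨n, rfl⟩
  exact h _ (sub_lt_self t (by positivity))

theorem Bounded.exists_zero_one (hx : x.Bounded) :
    ∃ s t, x.toFun (bIio s) = EA.zero ∧ x.toFun (bIio t) = EA.one := by
  obtain ⟨C, hC, hCx⟩ := hx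
  obtain ⟨K, hK⟩ := hC.isBounded.subset_closedBall 0
  rw [Real.closedBall_eq_Icc] at hK
  refine ⟨0 - K, 0 + K + 1, ?_, ?_⟩
  · have h := x.additive (bIio (0 - K)) ⟨C, hC.measurableSet⟩ (by
      rw [Set.disjoint_left]
      intro t ht htC
      exact absurd (hK htC).1 (not_le.2 ht))
    rw [hCx] at h
    exact EA.pos_one _ _ h
  · refine (EA.le_one _).antisymm ?_
    rw [← hCx]
    exact x.mono fun t ht => (hK ht).2.trans_lt (lt_add_one _)

theorem bounded_of_zero_one {s t : ℝ} (hs : x.toFun (bIio s) = EA.zero)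
    (ht : x.toFun (bIio t) = EA.one) : x.Bounded := by
  refine ⟨Icc s t, isCompact_Icc, ?_⟩
  have h := x.additive (bIio s) ⟨Icc s t, measurableSet_Icc⟩ (by
    rw [Set.disjoint_left]
    intro u hu hu'
    exact absurd hu'.1 (not_le.2 hu))
  rw [hs, EA.zero_add] at h
  rw [Option.some_injective _ h]
  refine (EA.le_one _).antisymm ?_
  rw [← ht]
  refine x.mono fun u hu => ?_
  rcases lt_or_ge u s with h' | h'
  · exact Or.inl h'
  · exact Or.inr ⟨h', le_of_lt hu⟩

theorem Bounded.spectralResolution (hx : x.Bounded) :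
    SpectralResolution EA fun t => x.toFun (bIio t) := by
  obtain ⟨s₀, t₀, hs, ht⟩ := hx.exists_zero_one
  refine ⟨fun t s h => x.mono (Iio_subset_Iio h.le), ⟨fun a _ => EA.zero_le a, fun b hb => ?_⟩,
    ⟨fun a _ => EA.le_one a, fun b hb => ?_⟩, fun s => ⟨?_, fun b hb => ?_⟩⟩
  · rw [← hs]
    exact hb _ ⟨s₀, rfl⟩
  · rw [← ht]
    exact hb _ ⟨t₀, rfl⟩
  · rintro _ ⟨t, h, rfl⟩
    exact x.mono (Iio_subset_Iio (le_of_lt h))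
  · exact x.le_of_forall_lt fun t h => hb _ ⟨t, h, rfl⟩

theorem apply_compl_unique {A : BorelSet} (h : x.toFun A = y.toFun A) :
    x.toFun ⟨A.1ᶜ, A.2.compl⟩ = y.toFun ⟨A.1ᶜ, A.2.compl⟩ := by
  have key : ∀ z : Observable EA,
      EA.add (z.toFun A) (z.toFun ⟨A.1ᶜ, A.2.compl⟩) = some EA.one := fun z => by
    rw [z.additive A ⟨A.1ᶜ, A.2.compl⟩ disjoint_compl_right, ← z.unital]
    congr 2
    exact Subtype.ext (union_compl_self _)
  have hx := key x
  rw [h] at hx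
  exact EA.add_left_cancel hx (key y)

theorem apply_union_unique {A B : BorelSet} (hA : x.toFun A = y.toFun A)
    (hB : x.toFun B = y.toFun B) (h : Disjoint A.1 B.1) :
    x.toFun ⟨A.1 ∪ B.1, A.2.union B.2⟩ = y.toFun ⟨A.1 ∪ B.1, A.2.union B.2⟩ := by
  have hx := x.additive A B h
  rw [hA, hB, y.additive A B h] at hx
  exact (Option.some_injective _ hx).symm

/-- An observable is determined by its spectral resolution. -/
theorem ext_of_Iio (h : ∀ t, x.toFun (bIio t) = y.toFun (bIio t)) : x = y := by
  suffices hfun : x.toFun = y.toFun by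
    cases x; cases y; congr
  suffices hset : ∀ A (hA : MeasurableSet A), x.toFun ⟨A, hA⟩ = y.toFun ⟨A, hA⟩ from
    funext fun A => hset A.1 A.2
  refine MeasurableSpace.induction_on_inter
    (BorelSpace.measurable_eq.trans (borel_eq_generateFrom_Iio ℝ)) isPiSystem_Iio ?_ ?_ ?_ ?_
  · have h1 : x.toFun ⟨univ, MeasurableSet.univ⟩ = y.toFun ⟨univ, MeasurableSet.univ⟩ :=
      x.unital.trans y.unital.symm
    have h2 := apply_compl_unique h1
    simpa using h2
  · rintro _ ⟨t, rfl⟩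
    exact h t
  · intro A hA hxy
    exact apply_compl_unique hxy
  · intro f hdisj hf hxy
    have hm : ∀ n, MeasurableSet (accumulate f n) := fun n => by
      rw [accumulate_def]
      exact MeasurableSet.biUnion (to_countable _) fun i _ => hf i
    have hacc : ∀ n, x.toFun ⟨accumulate f n, hm n⟩ = y.toFun ⟨accumulate f n, hm n⟩ := by
      intro n
      induction n with
      | zero => simpa using hxy 0
      | succ n ih =>
        have := apply_union_unique ih (hxy (n + 1)) (disjoint_accumulate hdisj n.lt_succ_self)
        simpa only [accumulate_succ] using this
    have hstep : ∀ n, accumulate f n ⊆ accumulate f (n + 1) := fun n =>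
      monotone_accumulate n.le_succ
    have hx := x.sup_cont (fun n => ⟨accumulate f n, hm n⟩) hstep
    have hy := y.sup_cont (fun n => ⟨accumulate f n, hm n⟩) hstep
    simp only [hacc] at hx
    have := hx.unique hy
    simpa only [iUnion_accumulate] using this

end Observable

/-- for a family of bounded observables with a bounded lower bound,
`x(t) := ⋁_α x_α((-∞,t))` is a spectral resolution determining a unique bounded
observable, which is the greatest lower bound in the Olson order. -/
theorem stmt10 {E : Type*} {A : Type*} [Nonempty A]
    (EA : EffectAlgebra E) (hE : EA.CompleteEA)
    (x_ : A → Observable EA) (hb : ∀ α, (x_ α).Bounded)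
    (y : Observable EA) (hy : y.Bounded) (hlow : ∀ α, y.OlsonLe (x_ α)) :
    ∃! z : Observable EA,
      (∀ t : ℝ, EA.IsSup (Set.range fun α => (x_ α).toFun (bIio t)) (z.toFun (bIio t))) ∧
      SpectralResolution EA (fun t => z.toFun (bIio t)) ∧
      z.Bounded ∧
      Observable.IsOlsonInf (Set.range x_) z := by
  choose F hF using fun t : ℝ => hE.1 (Set.range fun α => (x_ α).toFun (bIio t))
  have hle : ∀ α t, EA.le ((x_ α).toFun (bIio t)) (F t) := fun α t => (hF t).1 _ ⟨α, rfl⟩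
  have hmono : ∀ s t, s ≤ t → EA.le (F s) (F t) := by
    refine fun s t hst => (hF s).2 _ ?_
    rintro _ ⟨α, rfl⟩
    exact ((x_ α).mono (Set.Iio_subset_Iio hst)).trans (hle α t)
  have hsup : ∀ t, EA.IsSup (F '' Set.Iio t) (F t) := by
    refine fun t => ⟨?_, fun b h => (hF t).2 b ?_⟩
    · rintro _ ⟨s, hs, rfl⟩
      exact hmono s t (le_of_lt hs)
    · rintro _ ⟨α, rfl⟩
      exact (x_ α).le_of_forall_lt fun s hs => (hle α s).trans (h _ ⟨s, hs, rfl⟩)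
  have hzero : ∃ t, F t = EA.zero := by
    obtain ⟨s, -, hs, -⟩ := hy.exists_zero_one
    refine ⟨s, EffectAlgebra.le.antisymm ((hF s).2 _ ?_) (EA.zero_le _)⟩
    rintro _ ⟨α, rfl⟩
    rw [← hs]
    exact hlow α s
  have hone : ∃ t, F t = EA.one := by
    obtain ⟨α⟩ := ‹Nonempty A›
    obtain ⟨-, t, -, ht⟩ := (hb α).exists_zero_one
    exact ⟨t, (EA.le_one _).antisymm (ht ▸ hle α t)⟩
  obtain ⟨z, hz⟩ := EffectAlgebra.exists_observable hE hmono hsup hzero hone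
  have hzsup : ∀ t, EA.IsSup (Set.range fun α => (x_ α).toFun (bIio t)) (z.toFun (bIio t)) :=
    fun t => by rw [hz]; exact hF t
  have hzb : z.Bounded := by
    obtain ⟨s, hs⟩ := hzero
    obtain ⟨t, ht⟩ := hone
    exact Observable.bounded_of_zero_one ((hz s).trans hs) ((hz t).trans ht)
  refine ⟨z, ⟨hzsup, hzb.spectralResolution, hzb, hzb, ?_, ?_⟩, fun w hw =>
    Observable.ext_of_Iio fun t => (hw.1 t).unique (hzsup t)⟩
  · rintro _ ⟨α, rfl⟩ t
    exact (hzsup t).1 _ ⟨α, rfl⟩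
  · intro w _ hw t
    refine (hzsup t).2 _ ?_
    rintro _ ⟨α, rfl⟩
    exact hw _ ⟨α, rfl⟩ t
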